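/- Let D=(V∪S, A*) be a digraph where S is a set of vertices disjoint from V, A' is the set of arcs of A* leaving S and A = A* − A', such that no arc of A* enters any vertex of S and exactly one arc leaves each vertex of S. Let ℓ, ℓ' be non-negative integers and M a matroid on S with rank function r_M. There exists an M-reachability-based packing of arborescences in D using at least ℓ and at most ℓ' arcs of A' if and only if: (i) ℓ ≤ ℓ'; (ii) Σ_{v∈V} r_M(N⁻_{A'}(v)) ≥ ℓ; (iii) r_M(S ∩ P_Z) − r_M(S ∩ Z) ≤ d⁻_{A*}(Z) for every petal Z of D; and (iv) Σ_{Z∈𝒵} (r_M(S ∩ P_Z) − r_M(S ∩ Z) − d⁻_A(Z)) ≤ ℓ' for every A'-disjoint core-laminar set 𝒵 of petals of D. -/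

import Mathlib

open Finset

attribute [local instance] Classical.propDecidable

section Defs

variable {V α : Type} [Fintype V] [DecidableEq V] [Fintype α] [DecidableEq α]

/-- One step along an arc of the arc set `B`, for a digraph given by tail and head maps. -/
def DStep (tl hd : α → V) (B : Finset α) (u w : V) : Prop :=
  ∃ a ∈ B, tl a = u ∧ hd a = w

/-- Reachability by a directed path using only arcs of `B`. -/
def DReach (tl hd : α → V) (B : Finset α) : V → V → Prop :=
  Relation.ReflTransGen (DStep tl hd B)

/-- In-degree of a vertex set `X`, counting arcs of `B` with tail outside `X` and head in `X`. -/
noncomputable def inDegB (tl hd : α → V) (B : Finset α) (X : Finset V) : ℕ :=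
  (B.filter fun a => tl a ∉ X ∧ hd a ∈ X).card

/-- `PReach X` is the set of vertices from which some vertex of `X` is reachable. -/
noncomputable def PReach (tl hd : α → V) (X : Finset V) : Finset V :=
  univ.filter fun u => ∃ w ∈ X, DReach tl hd univ u w

/-- A subatom: a non-empty set of pairwise mutually reachable vertices. -/
def IsSubatom (tl hd : α → V) (C : Finset V) : Prop :=
  C.Nonempty ∧ ∀ u ∈ C, ∀ w ∈ C, DReach tl hd univ u w

/-- An atom: a maximal subatom, i.e. a strongly connected component. -/
def IsAtomOf (tl hd : α → V) (C : Finset V) : Prop :=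
  IsSubatom tl hd C ∧ ∀ C', IsSubatom tl hd C' → C ⊆ C' → C' = C

/-- A petal: `Z` meets an atom `C`, `Z ⊆ P_C`, and no arc enters `Z - C`. -/
def IsPetal (tl hd : α → V) (Z : Finset V) : Prop :=
  ∃ C, IsAtomOf tl hd C ∧ (Z ∩ C).Nonempty ∧ Z ⊆ PReach tl hd C ∧
    inDegB tl hd univ (Z \ C) = 0

/-- The (unique) atom witnessing that `Z` is a petal. -/
noncomputable def petalAtom (tl hd : α → V) (Z : Finset V) : Finset V :=
  if h : IsPetal tl hd Z then h.choose else ∅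

/-- The core of a petal `Z`. -/
noncomputable def petalCore (tl hd : α → V) (Z : Finset V) : Finset V :=
  petalAtom tl hd Z ∩ Z

/-- An `R`-branching with vertex set `U` and arc set `F`: roots have in-degree 0,
every other vertex of `U` has in-degree exactly 1, and every vertex of `U` is
reachable from some root (equivalently, unique paths from the root set). -/
def IsBranching (tl hd : α → V) (F : Finset α) (R U : Finset V) : Prop :=
  R ⊆ U ∧ (∀ a ∈ F, tl a ∈ U ∧ hd a ∈ U) ∧
  (∀ a ∈ F, hd a ∉ R) ∧
  (∀ w ∈ U, w ∉ R → (F.filter fun a => hd a = w).card = 1) ∧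
  (∀ w ∈ U, ∃ s ∈ R, DReach tl hd F s w)

/-- An `s`-arborescence with vertex set `U` and arc set `F`. -/
def IsArbor (tl hd : α → V) (F : Finset α) (s : V) (U : Finset V) : Prop :=
  IsBranching tl hd F {s} U

end Defs

/-- A matroid on a finite ground set `σ`, given by its rank function. -/
structure RankFn (σ : Type) [DecidableEq σ] [Fintype σ] where
  r : Finset σ → ℕ
  r_empty : r ∅ = 0
  r_le_card : ∀ X, r X ≤ X.card
  r_mono : ∀ ⦃X Y : Finset σ⦄, X ⊆ Y → r X ≤ r Y
  r_submod : ∀ X Y, r (X ∪ Y) + r (X ∩ Y) ≤ r X + r Y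

/-- `B` is a basis of `T` for the rank function `r`. -/
def IsBasisOf {σ : Type} [DecidableEq σ] [Fintype σ]
    (r : Finset σ → ℕ) (B T : Finset σ) : Prop :=
  B ⊆ T ∧ r B = B.card ∧ r B = r T

/-- For a multiset `S` of vertices given by `loc : σ → V`, the sub-multiset `S_X`
of elements lying in `X`. -/
noncomputable def SX {V σ : Type} [DecidableEq V] [Fintype σ]
    (loc : σ → V) (X : Finset V) : Finset σ :=
  univ.filter fun s => loc s ∈ X

set_option linter.unusedSectionVars false

section RankLemmas

variable {σ : Type} [DecidableEq σ] [Fintype σ] (M : RankFn σ)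

namespace RankFn

/-- `x` lies in the closure of `X`. -/
def Cl (X : Finset σ) (x : σ) : Prop := M.r (insert x X) = M.r X

lemma r_insert_le (X : Finset σ) (x : σ) : M.r (insert x X) ≤ M.r X + 1 := by
  have h := M.r_submod X {x}
  have h1 := M.r_le_card {x}
  have h2 : X ∪ {x} = insert x X := by ext; simp
  rw [h2] at h
  simp at h1
  omega

lemma r_insert_of_not_cl {X : Finset σ} {x : σ} (h : ¬ M.Cl X x) :
    M.r (insert x X) = M.r X + 1 := by
  have h1 := M.r_insert_le X x
  have h2 := M.r_mono (subset_insert x X)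
  unfold Cl at h
  omega

variable {M}

lemma cl_of_mem {X : Finset σ} {x : σ} (h : x ∈ X) : M.Cl X x := by
  unfold Cl; rw [insert_eq_of_mem h]

lemma Cl.mono {X Y : Finset σ} {x : σ} (h : M.Cl X x) (hXY : X ⊆ Y) : M.Cl Y x := by
  by_cases hx : x ∈ Y
  · exact cl_of_mem hx
  have h1 := M.r_submod (insert x X) Y
  have h2 : insert x X ∪ Y = insert x Y := by
    ext z; simp only [mem_union, mem_insert]; have := @hXY z; tauto
  have h3 : insert x X ∩ Y = X := by
    ext z; simp only [mem_inter, mem_insert]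
    constructor
    · rintro ⟨rfl | h, h'⟩
      · exact absurd h' hx
      · exact h
    · exact fun h => ⟨Or.inr h, hXY h⟩
  have h4 := M.r_mono (subset_insert x Y)
  unfold Cl at h ⊢
  rw [h2, h3] at h1
  omega

lemma r_union_of_cl {X Y : Finset σ} (h : ∀ y ∈ Y, M.Cl X y) : M.r (X ∪ Y) = M.r X := by
  induction Y using Finset.induction_on with
  | empty => simp
  | insert y Y _ ih =>
    have h1 := ih fun z hz => h z (mem_insert_of_mem hz)
    have h2 := (h y (mem_insert_self y Y)).mono (subset_union_left (s₂ := Y))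
    unfold Cl at h2
    rw [union_insert, h2, h1]

lemma cl_trans {X Y : Finset σ} {x : σ} (h : ∀ y ∈ Y, M.Cl X y) (hx : M.Cl Y x) :
    M.Cl X x := by
  have h1 := r_union_of_cl h
  have h2 : M.Cl (X ∪ Y) x := hx.mono subset_union_right
  have h3 := M.r_mono (insert_subset_insert x (subset_union_left (s₁ := X) (s₂ := Y)))
  have h4 := M.r_mono (subset_insert x X)
  unfold Cl at h2 ⊢
  omega

lemma cl_of_r_le {X Y : Finset σ} {x : σ} (hXY : X ⊆ Y) (hr : M.r Y ≤ M.r X)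
    (hx : M.Cl Y x) : M.Cl X x := by
  have h3 := M.r_mono (insert_subset_insert x hXY)
  have h4 := M.r_mono (subset_insert x X)
  unfold Cl at hx ⊢
  omega

lemma indep_subset {X B : Finset σ} (hB : M.r B = B.card) (h : X ⊆ B) :
    M.r X = X.card := by
  have h1 := M.r_submod X (B \ X)
  rw [union_sdiff_of_subset h] at h1
  have h2 := M.r_le_card (B \ X)
  have h3 := card_sdiff_add_card_eq_card h
  have h4 := M.r_le_card X
  omega

lemma exists_indep_extension {I X : Finset σ} (hI : M.r I = I.card) (h : I ⊆ X) :
    ∃ J, I ⊆ J ∧ J ⊆ X ∧ M.r J = J.card ∧ J.card = M.r X := by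
  obtain ⟨J, hJ, hmax⟩ := Finset.exists_max_image
    (X.powerset.filter fun J => I ⊆ J ∧ M.r J = J.card) Finset.card ⟨I, by simp [h, hI]⟩
  simp only [mem_filter, mem_powerset] at hJ hmax
  refine ⟨J, hJ.2.1, hJ.1, hJ.2.2, ?_⟩
  have hcl : ∀ x ∈ X, M.Cl J x := by
    intro x hx
    by_contra hn
    have h1 := M.r_insert_of_not_cl hn
    have hxJ : x ∉ J := fun hxJ => hn (cl_of_mem hxJ)
    have := hmax (insert x J) ⟨insert_subset hx hJ.1, hJ.2.1.trans (subset_insert _ _), by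
      rw [h1, card_insert_of_notMem hxJ, hJ.2.2]⟩
    rw [card_insert_of_notMem hxJ] at this
    omega
  have h2 := r_union_of_cl hcl
  rw [union_eq_right.2 hJ.1] at h2
  rw [h2, hJ.2.2]

lemma r_filter_nonloop (X : Finset σ) : M.r (X.filter fun s => M.r {s} = 1) = M.r X := by
  have h : ∀ y ∈ X, M.Cl (X.filter fun s => M.r {s} = 1) y := by
    intro y hy
    by_cases h1 : M.r {y} = 1
    · exact cl_of_mem (by simp [hy, h1])
    · have h2 := M.r_le_card {y}
      rw [card_singleton] at h2
      refine Cl.mono (X := ∅) ?_ (empty_subset _)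
      unfold Cl
      rw [M.r_empty, insert_empty_eq]
      omega
  rw [← r_union_of_cl h, union_eq_right.2 (filter_subset _ _)]

end RankFn

end RankLemmas

section Petals

variable {W α : Type} [Fintype W] [DecidableEq W] [Fintype α] [DecidableEq α]
  {tl hd : α → W}

lemma DReach.mono {B B' : Finset α} (h : B ⊆ B') {u w : W} (hr : DReach tl hd B u w) :
    DReach tl hd B' u w :=
  Relation.ReflTransGen.mono (r := DStep tl hd B) (p := DStep tl hd B')
    (fun _ _ ⟨a, ha, h'⟩ => ⟨a, h ha, h'⟩) _ _ hr

lemma DReach.arc {B : Finset α} {a : α} (ha : a ∈ B) : DReach tl hd B (tl a) (hd a) :=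
  Relation.ReflTransGen.single ⟨a, ha, rfl, rfl⟩

/-- A directed path from outside `Z` to `Z` contains an arc entering `Z`. -/
lemma DReach.exists_entering {B : Finset α} {u w : W} (hr : DReach tl hd B u w) {Z : Finset W}
    (hu : u ∉ Z) (hw : w ∈ Z) : ∃ a ∈ B, tl a ∉ Z ∧ hd a ∈ Z := by
  induction hr with
  | refl => exact absurd hw hu
  | @tail x y _ hs ih =>
    obtain ⟨a, ha, rfl, rfl⟩ := hs
    by_cases hx : tl a ∈ Z
    · exact ih hx
    · exact ⟨a, ha, hx, hw⟩

/-- A vertex entered by no arc is reachable only from itself. -/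
lemma DReach.eq_of_no_arc {B : Finset α} {u w : W} (hr : DReach tl hd B u w)
    (h : ∀ a, hd a ≠ w) : u = w := by
  by_contra hne
  obtain ⟨a, _, _, ha⟩ := hr.exists_entering (Z := {w}) (by simpa using hne) (by simp)
  exact h a (by simpa using ha)

/-- `Z` is a petal whose core contains `v`. -/
def PetalAt (tl hd : α → W) (v : W) (Z : Finset W) : Prop :=
  v ∈ Z ∧ (∀ z ∈ Z, DReach tl hd univ z v) ∧
    ∀ a, hd a ∈ Z → tl a ∈ Z ∨ DReach tl hd univ v (hd a)

lemma mem_PReach {X : Finset W} {u : W} :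
    u ∈ PReach tl hd X ↔ ∃ w ∈ X, DReach tl hd univ u w := by
  simp [PReach]

lemma mem_PReach_singleton {u v : W} :
    u ∈ PReach tl hd {v} ↔ DReach tl hd univ u v := by
  simp [PReach]

lemma PReach_singleton_subset {u v : W} (h : DReach tl hd univ u v) :
    PReach tl hd {u} ⊆ PReach tl hd {v} := fun x hx => by
  rw [mem_PReach_singleton] at hx ⊢; exact hx.trans h

namespace PetalAt

lemma PReach_eq {v : W} {Z : Finset W} (h : PetalAt tl hd v Z) :
    PReach tl hd Z = PReach tl hd {v} := by
  ext u
  rw [mem_PReach, mem_PReach_singleton]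
  exact ⟨fun ⟨w, hw, hr⟩ => hr.trans (h.2.1 w hw), fun hr => ⟨v, h.1, hr⟩⟩

lemma change {v w : W} {Z : Finset W} (h : PetalAt tl hd v Z) (hw : w ∈ Z)
    (hvw : DReach tl hd univ v w) : PetalAt tl hd w Z :=
  ⟨hw, fun z hz => (h.2.1 z hz).trans hvw, fun a ha =>
    (h.2.2 a ha).imp_right fun hr => (h.2.1 w hw).trans hr⟩

lemma at_head {v : W} {Z : Finset W} (h : PetalAt tl hd v Z) {a : α} (ht : tl a ∉ Z)
    (ha : hd a ∈ Z) : PetalAt tl hd (hd a) Z :=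
  h.change ha ((h.2.2 a ha).resolve_left ht)

lemma union {v : W} {Z Z' : Finset W} (h : PetalAt tl hd v Z) (h' : PetalAt tl hd v Z') :
    PetalAt tl hd v (Z ∪ Z') := by
  refine ⟨mem_union_left _ h.1, fun z hz => ?_, fun a ha => ?_⟩
  · rcases mem_union.1 hz with hz | hz
    exacts [h.2.1 z hz, h'.2.1 z hz]
  · rcases mem_union.1 ha with ha | ha
    exacts [(h.2.2 a ha).imp_left (mem_union_left _), (h'.2.2 a ha).imp_left (mem_union_right _)]

lemma inter {v : W} {Z Z' : Finset W} (h : PetalAt tl hd v Z) (h' : PetalAt tl hd v Z') :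
    PetalAt tl hd v (Z ∩ Z') := by
  refine ⟨mem_inter.2 ⟨h.1, h'.1⟩, fun z hz => h.2.1 z (mem_inter.1 hz).1, fun a ha => ?_⟩
  rw [mem_inter] at ha ⊢
  have h1 := h.2.2 a ha.1
  have h2 := h'.2.2 a ha.2
  tauto

lemma transfer {v w : W} {Z Z' : Finset W} (hv : PetalAt tl hd v Z) (hw : PetalAt tl hd w Z)
    (hw' : PetalAt tl hd w Z') (hvZ' : v ∈ Z') : PetalAt tl hd v Z' :=
  hw'.change hvZ' (hv.2.1 w hw.1)

/-- Adding vertices entered by no arc that reach the core preserves petals. -/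
lemma union_sources {v : W} {Z Y : Finset W} (h : PetalAt tl hd v Z)
    (hY : ∀ y ∈ Y, DReach tl hd univ y v) (hY' : ∀ a, hd a ∉ Y) :
    PetalAt tl hd v (Z ∪ Y) := by
  refine ⟨mem_union_left _ h.1, fun z hz => ?_, fun a ha => ?_⟩
  · rcases mem_union.1 hz with hz | hz
    exacts [h.2.1 z hz, hY z hz]
  · rcases mem_union.1 ha with ha | ha
    exacts [(h.2.2 a ha).imp_left (mem_union_left _), absurd ha (hY' a)]

end PetalAt

lemma petalAt_PReach (v : W) : PetalAt tl hd v (PReach tl hd {v}) := by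
  refine ⟨mem_PReach_singleton.2 .refl, fun z hz => mem_PReach_singleton.1 hz, fun a ha => ?_⟩
  rw [mem_PReach_singleton] at ha ⊢
  exact Or.inl ((DReach.arc (mem_univ a)).trans ha)

lemma petalAt_of_atom {C Z : Finset W} (hC : IsAtomOf tl hd C) (hP : Z ⊆ PReach tl hd C)
    (hdeg : inDegB tl hd univ (Z \ C) = 0) {v : W} (hv : v ∈ C) (hvZ : v ∈ Z) :
    PetalAt tl hd v Z := by
  refine ⟨hvZ, fun z hz => ?_, fun a ha => ?_⟩
  · obtain ⟨w, hw, hr⟩ := mem_PReach.1 (hP hz)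
    exact hr.trans (hC.1.2 w hw v hv)
  · by_cases hac : hd a ∈ C
    · exact Or.inr (hC.1.2 v hv _ hac)
    · left
      rw [inDegB, card_eq_zero, filter_eq_empty_iff] at hdeg
      have := hdeg (mem_univ a)
      simp only [mem_sdiff] at this
      tauto

lemma PetalAt.isPetal {v : W} {Z : Finset W} (h : PetalAt tl hd v Z) : IsPetal tl hd Z := by
  have hrefl : DReach tl hd univ v v := Relation.ReflTransGen.refl
  refine ⟨univ.filter fun w => DReach tl hd univ v w ∧ DReach tl hd univ w v,
    ⟨⟨⟨v, by simp [hrefl]⟩, ?_⟩, ?_⟩, ⟨v, ?_⟩, ?_, ?_⟩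
  · intro u hu w hw
    simp only [mem_filter, mem_univ, true_and] at hu hw
    exact hu.2.trans hw.1
  · intro C' hC' hsub
    refine Subset.antisymm (fun w hw => ?_) hsub
    have hv : v ∈ C' := hsub (by simp [hrefl])
    simpa using ⟨hC'.2 v hv w hw, hC'.2 w hw v hv⟩
  · simp [h.1, hrefl]
  · intro z hz
    exact mem_PReach.2 ⟨v, by simp [hrefl], h.2.1 z hz⟩
  · rw [inDegB, card_eq_zero, filter_eq_empty_iff]
    rintro a - ⟨h1, h2⟩
    simp only [mem_sdiff, mem_filter, mem_univ, true_and, not_and] at h1 h2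
    have hva : ¬ DReach tl hd univ v (hd a) := fun hr => h2.2 hr (h.2.1 _ h2.1)
    have hta := (h.2.2 a h2.1).resolve_right hva
    exact h1 hta fun hr => absurd (hr.trans (DReach.arc (mem_univ a))) hva

lemma isPetal_iff {Z : Finset W} : IsPetal tl hd Z ↔ ∃ v, PetalAt tl hd v Z := by
  refine ⟨fun ⟨C, hC, ⟨v, hv⟩, hP, hdeg⟩ => ⟨v, ?_⟩, fun ⟨v, hv⟩ => hv.isPetal⟩
  rw [mem_inter] at hv
  exact petalAt_of_atom hC hP hdeg hv.2 hv.1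

lemma mem_petalCore {Z : Finset W} (hZ : IsPetal tl hd Z) {v : W} :
    v ∈ petalCore tl hd Z ↔ PetalAt tl hd v Z := by
  rw [petalCore, petalAtom, dif_pos hZ, mem_inter]
  obtain ⟨hC, ⟨z, hz⟩, hP, hdeg⟩ := hZ.choose_spec
  refine ⟨fun h => petalAt_of_atom hC hP hdeg h.1 h.2, fun h => ⟨?_, h.1⟩⟩
  set C := hZ.choose
  rw [mem_inter] at hz
  obtain ⟨c, hc, hvc⟩ := mem_PReach.1 (hP h.1)
  have hzv := h.2.1 z hz.1
  have key : insert v C = C := by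
    refine hC.2 _ ⟨⟨v, mem_insert_self _ _⟩, ?_⟩ (subset_insert _ _)
    have hto : ∀ u ∈ insert v C, DReach tl hd univ u z := by
      intro u hu
      rcases mem_insert.1 hu with rfl | hu
      exacts [hvc.trans (hC.1.2 c hc z hz.2), hC.1.2 u hu z hz.2]
    have hfrom : ∀ u ∈ insert v C, DReach tl hd univ z u := by
      intro u hu
      rcases mem_insert.1 hu with rfl | hu
      exacts [hzv, hC.1.2 z hz.2 u hu]
    exact fun u hu w hw => (hto u hu).trans (hfrom w hw)
  rw [← key]
  exact mem_insert_self _ _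

lemma inDegB_submod (B : Finset α) (X Y : Finset W) :
    inDegB tl hd B (X ∪ Y) + inDegB tl hd B (X ∩ Y) ≤ inDegB tl hd B X + inDegB tl hd B Y := by
  simp only [inDegB, card_filter, ← sum_add_distrib]
  refine sum_le_sum fun a _ => ?_
  simp only [mem_union, mem_inter]
  by_cases h1 : tl a ∈ X <;> by_cases h2 : tl a ∈ Y <;> by_cases h3 : hd a ∈ X <;>
    by_cases h4 : hd a ∈ Y <;> simp [h1, h2, h3, h4]

lemma IsArbor.root_mem {F : Finset α} {s : W} {U : Finset W} (h : IsArbor tl hd F s U) :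
    s ∈ U := h.1 (mem_singleton_self s)

lemma IsArbor.reach {F : Finset α} {s : W} {U : Finset W} (h : IsArbor tl hd F s U) {w : W}
    (hw : w ∈ U) : DReach tl hd F s w := by
  simpa using h.2.2.2.2 w hw

end Petals

section Covering

variable {W α : Type} [Fintype W] [DecidableEq W] [Fintype α] [DecidableEq α]
  {tl hd : α → W} {p : Finset W → ℤ}

/-- The number of members of the family `y` entered by the arc `a`. -/
noncomputable def load (tl hd : α → W) {ι : Type} [Fintype ι] (y : ι → Finset W) (a : α) : ℕ :=
  (univ.filter fun i => tl a ∉ y i ∧ hd a ∈ y i).card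

/-- A family of petals is core-laminar if any two core-intersecting members are nested. -/
def CoreLaminar (tl hd : α → W) {ι : Type} (y : ι → Finset W) : Prop :=
  ∀ i j v, PetalAt tl hd v (y i) → PetalAt tl hd v (y j) → y i ⊆ y j ∨ y j ⊆ y i

/-- `p` is supermodular on core-intersecting petals. -/
def CoreSupermodular (tl hd : α → W) (p : Finset W → ℤ) : Prop :=
  ∀ v Z Z', PetalAt tl hd v Z → PetalAt tl hd v Z' → p Z + p Z' ≤ p (Z ∪ Z') + p (Z ∩ Z')

/-- The arc `a` enters the vertex set `Z`, as a `0`-`1` value. -/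
noncomputable def entInd (tl hd : α → W) (a : α) (Z : Finset W) : ℕ :=
  if tl a ∉ Z ∧ hd a ∈ Z then 1 else 0

lemma load_eq_sum {ι : Type} [Fintype ι] (y : ι → Finset W) (a : α) :
    load tl hd y a = ∑ i, entInd tl hd a (y i) := by
  simp only [load, card_filter, entInd]

lemma entInd_submod (a : α) (X Y : Finset W) :
    entInd tl hd a (X ∪ Y) + entInd tl hd a (X ∩ Y) ≤ entInd tl hd a X + entInd tl hd a Y := by
  simp only [entInd, mem_union, mem_inter]
  by_cases h1 : tl a ∈ X <;> by_cases h2 : tl a ∈ Y <;> by_cases h3 : hd a ∈ X <;>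
    by_cases h4 : hd a ∈ Y <;> simp [h1, h2, h3, h4]

lemma sum_two_update {ι β M : Type} [Fintype ι] [AddCommMonoid M]
    (f : β → M) (y : ι → β) {i j : ι} (hij : i ≠ j) (b c : β) :
    ∑ k, f (Function.update (Function.update y i b) j c k) + (f (y i) + f (y j)) =
      ∑ k, f (y k) + (f b + f c) := by
  have key : ∀ g : ι → M, ∑ k, g k = g i + (g j + ∑ k ∈ (univ.erase i).erase j, g k) := by
    intro g
    rw [add_sum_erase _ g (mem_erase.2 ⟨hij.symm, mem_univ j⟩), add_sum_erase _ g (mem_univ i)]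
  rw [key, key fun k => f (y k)]
  have hrest : ∑ k ∈ (univ.erase i).erase j, f (Function.update (Function.update y i b) j c k) =
      ∑ k ∈ (univ.erase i).erase j, f (y k) := by
    refine sum_congr rfl fun k hk => ?_
    simp only [mem_erase] at hk
    rw [Function.update_of_ne hk.1, Function.update_of_ne hk.2.1]
  rw [hrest, Function.update_self, Function.update_of_ne hij, Function.update_self]
  abel

/-- Uncrossing a family of petals. -/
lemma exists_coreLaminar (hp : CoreSupermodular tl hd p) {ι : Type} [Fintype ι]
    (y : ι → Finset W) (hy : ∀ i, ∃ v, PetalAt tl hd v (y i)) :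
    ∃ y' : ι → Finset W, (∀ i, ∃ v, PetalAt tl hd v (y' i)) ∧ CoreLaminar tl hd y' ∧
      (∀ a, load tl hd y' a ≤ load tl hd y a) ∧ ∑ i, p (y i) ≤ ∑ i, p (y' i) := by
  obtain ⟨z, hz, hmax⟩ := Finset.exists_max_image
    (univ.filter fun z : ι → Finset W => (∀ i, ∃ v, PetalAt tl hd v (z i)) ∧
      (∀ a, load tl hd z a ≤ load tl hd y a) ∧ ∑ i, p (y i) ≤ ∑ i, p (z i))
    (fun z => ∑ i, (z i).card ^ 2) ⟨y, by simp [hy]⟩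
  simp only [mem_filter, mem_univ, true_and] at hz hmax
  refine ⟨z, hz.1, fun i j v hi hj => ?_, hz.2.1, hz.2.2⟩
  by_contra hcross
  push Not at hcross
  have hij : i ≠ j := by rintro rfl; exact hcross.1 (Subset.refl _)
  refine absurd (hmax (Function.update (Function.update z i (z i ∪ z j)) j (z i ∩ z j))
    ⟨fun k => ?_, fun a => ?_, ?_⟩) (not_le.2 ?_)
  · by_cases hkj : k = j
    · subst hkj; exact ⟨v, by simpa using hi.inter hj⟩
    · rw [Function.update_of_ne hkj]
      by_cases hki : k = i
      · subst hki; exact ⟨v, by simpa using hi.union hj⟩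
      · rw [Function.update_of_ne hki]; exact hz.1 k
  · have h1 := sum_two_update (entInd tl hd a) z hij (z i ∪ z j) (z i ∩ z j)
    have h2 := entInd_submod (tl := tl) (hd := hd) a (z i) (z j)
    have h3 := hz.2.1 a
    rw [load_eq_sum] at h3 ⊢
    omega
  · have h1 := sum_two_update p z hij (z i ∪ z j) (z i ∩ z j)
    have h2 := hp v _ _ hi hj
    have h3 := hz.2.2
    omega
  · have h1 := sum_two_update (fun Z : Finset W => Z.card ^ 2) z hij (z i ∪ z j) (z i ∩ z j)
    have h2 := card_union_add_card_inter (z i) (z j)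
    have h3 : (z i ∩ z j).card < (z i).card := card_lt_card
      ⟨inter_subset_left, fun hs => hcross.1 (hs.trans inter_subset_right)⟩
    have h4 : (z i ∩ z j).card < (z j).card := card_lt_card
      ⟨inter_subset_right, fun hs => hcross.2 (hs.trans inter_subset_left)⟩
    have h5 : (z i).card ^ 2 + (z j).card ^ 2 < (z i ∪ z j).card ^ 2 + (z i ∩ z j).card ^ 2 := by
      nlinarith
    beta_reduce at h1
    omega

/-- The members of a core-laminar family of petals can be coloured such that each colour class
contains a balanced share of the members entered by any given arc. -/
lemma exists_coloring {ι : Type} [Fintype ι] (y : ι → Finset W)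
    (hpet : ∀ i, ∃ v, PetalAt tl hd v (y i)) (hy : CoreLaminar tl hd y)
    {N : ℕ} (hN : 0 < N) : ∃ col : ι → ℕ, (∀ i, col i < N) ∧
      ∀ a k, load tl hd y a ≤ N * k → ∀ c,
        (univ.filter fun i => (tl a ∉ y i ∧ hd a ∈ y i) ∧ col i = c).card ≤ k := by
  let e := Fintype.equivFin ι
  let above : ι → ι → Prop := fun i j =>
    (∃ v, PetalAt tl hd v (y i) ∧ PetalAt tl hd v (y j)) ∧
      (y i ⊂ y j ∨ y i = y j ∧ e i < e j)
  let depth : ι → ℕ := fun i => (univ.filter (above i)).card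
  refine ⟨fun i => depth i % N, fun i => Nat.mod_lt _ hN, fun a k hk c => ?_⟩
  have above_sub : ∀ {i j}, above i j → y i ⊆ y j := by
    rintro i j ⟨-, h | h⟩
    · exact h.1
    · exact h.1.subset
  have above_mem : ∀ {i j}, above i j → PetalAt tl hd (hd a) (y i) →
      PetalAt tl hd (hd a) (y j) := by
    intro i j hij hi
    obtain ⟨v, hv, hv'⟩ := hij.1
    exact hi.transfer hv hv' (above_sub hij hi.1)
  have above_total : ∀ {i j}, i ≠ j → PetalAt tl hd (hd a) (y i) →
      PetalAt tl hd (hd a) (y j) → above i j ∨ above j i := by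
    intro i j hij hi hj
    by_cases heq : y i = y j
    · rcases lt_or_gt_of_ne (fun h => hij (e.injective h) : e i ≠ e j) with h | h
      · exact Or.inl ⟨⟨_, hi, hj⟩, Or.inr ⟨heq, h⟩⟩
      · exact Or.inr ⟨⟨_, hj, hi⟩, Or.inr ⟨heq.symm, h⟩⟩
    · rcases hy i j _ hi hj with h | h
      · exact Or.inl ⟨⟨_, hi, hj⟩, Or.inl (h.ssubset_of_ne heq)⟩
      · exact Or.inr ⟨⟨_, hj, hi⟩, Or.inl (h.ssubset_of_ne (Ne.symm heq))⟩
  have above_trans : ∀ {i j l}, PetalAt tl hd (hd a) (y i) → above i j → above j l →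
      above i l := by
    intro i j l hi hij hjl
    refine ⟨⟨_, hi, above_mem hjl (above_mem hij hi)⟩, ?_⟩
    rcases hij.2 with h | h <;> rcases hjl.2 with h' | h'
    · exact Or.inl (h.trans h')
    · exact Or.inl (h'.1 ▸ h)
    · exact Or.inl (h.1 ▸ h')
    · exact Or.inr ⟨h.1.trans h'.1, h.2.trans h'.2⟩
  have above_irrefl : ∀ i, ¬ above i i := by
    rintro i ⟨-, h | h⟩
    · exact h.2 (Subset.refl _)
    · exact lt_irrefl _ h.2
  have depth_lt : ∀ {i j}, PetalAt tl hd (hd a) (y i) → above i j → depth j < depth i := by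
    intro i j hi hij
    refine card_lt_card ((ssubset_iff_of_subset fun l hl => ?_).2 ⟨j, ?_, ?_⟩)
    · simp only [mem_filter, mem_univ, true_and] at hl ⊢
      exact above_trans hi hij hl
    · simpa using hij
    · simpa using above_irrefl j
  have depth_inj : ∀ {i j}, PetalAt tl hd (hd a) (y i) → PetalAt tl hd (hd a) (y j) →
      depth i = depth j → i = j := by
    intro i j hi hj hd
    by_contra hne
    rcases above_total hne hi hj with h | h
    · exact absurd hd (depth_lt hi h).ne'
    · exact absurd hd (depth_lt hj h).ne
  set I : Finset ι := univ.filter fun i => tl a ∉ y i ∧ hd a ∈ y i with hI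
  set J : Finset ι := univ.filter fun i => PetalAt tl hd (hd a) (y i) with hJ
  have hIJ : ∀ {i}, tl a ∉ y i ∧ hd a ∈ y i → PetalAt tl hd (hd a) (y i) := by
    intro i hi
    obtain ⟨v, hv⟩ := hpet i
    exact hv.at_head hi.1 hi.2
  have hsub : I ⊆ J := by
    intro i hi
    simp only [hI, hJ, mem_filter, mem_univ, true_and] at hi ⊢
    exact hIJ hi
  have hcard : (J \ I).card + I.card = J.card := card_sdiff_add_card_eq_card hsub
  have hIk : I.card ≤ N * k := hk
  have lower : ∀ {i}, tl a ∉ y i ∧ hd a ∈ y i → (J \ I).card ≤ depth i := by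
    intro i hi
    refine card_le_card fun j hj => ?_
    simp only [hI, hJ, mem_sdiff, mem_filter, mem_univ, true_and] at hj ⊢
    have hne : i ≠ j := by rintro rfl; exact hj.2 hi
    refine (above_total hne (hIJ hi) hj.1).resolve_right fun h => hj.2 ⟨?_, hj.1.1⟩
    exact fun ht => hi.1 (above_sub h ht)
  have upper : ∀ {i}, tl a ∉ y i ∧ hd a ∈ y i → depth i < J.card := by
    intro i hi
    refine card_lt_card ((ssubset_iff_of_subset fun j hj => ?_).2 ⟨i, ?_, ?_⟩)
    · simp only [hJ, mem_filter, mem_univ, true_and] at hj ⊢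
      exact above_mem hj (hIJ hi)
    · simpa [hJ] using hIJ hi
    · simpa using above_irrefl i
  rw [← card_range k]
  refine card_le_card_of_injOn (fun i => (depth i - (J \ I).card) / N) (fun i hi => ?_) ?_
  · simp only [coe_filter, mem_univ, true_and, Set.mem_ofPred_eq] at hi
    have h1 := lower hi.1
    have h2 := upper hi.1
    simp only [coe_range, Set.mem_Iio]
    exact Nat.div_lt_of_lt_mul (by omega)
  · intro i hi j hj hij
    simp only [coe_filter, mem_univ, true_and, Set.mem_ofPred_eq] at hi hj hij
    obtain ⟨x, hx⟩ := Nat.exists_eq_add_of_le (lower hi.1)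
    obtain ⟨z, hz⟩ := Nat.exists_eq_add_of_le (lower hj.1)
    have hmod : (J \ I).card + x ≡ (J \ I).card + z [MOD N] := by
      rw [← hx, ← hz]; exact hi.2.trans hj.2.symm
    have hmod' : x % N = z % N := Nat.ModEq.add_left_cancel' _ hmod
    rw [hx, hz, Nat.add_sub_cancel_left, Nat.add_sub_cancel_left] at hij
    refine depth_inj (hIJ hi.1) (hIJ hj.1) ?_
    rw [hx, hz, ← Nat.div_add_mod x N, ← Nat.div_add_mod z N, hij, hmod']

/-- The value `n` is attained by a family of petals such that each arc `a` of `B` enters at most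
`c a` members of the family. -/
def Attains (tl hd : α → W) (p : Finset W → ℤ) (B : Finset α) (c : α → ℕ) (n : ℤ) : Prop :=
  ∃ (ι : Type) (_ : Fintype ι) (y : ι → Finset W), (∀ i, ∃ v, PetalAt tl hd v (y i)) ∧
    (∀ a ∈ B, load tl hd y a ≤ c a) ∧ n ≤ ∑ i, p (y i)

namespace Attains

variable {B B' : Finset α} {c c' : α → ℕ} {n n' : ℤ}

lemma zero : Attains tl hd p B c 0 :=
  ⟨Empty, inferInstance, Empty.elim, fun i => i.elim, fun a _ => by simp [load], by simp⟩

lemma mono (h : Attains tl hd p B c n) (hB : B' ⊆ B) (hc : ∀ a ∈ B', c a ≤ c' a) (hn : n' ≤ n) :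
    Attains tl hd p B' c' n' := by
  obtain ⟨ι, _, y, h1, h2, h3⟩ := h
  exact ⟨ι, inferInstance, y, h1, fun a ha => (h2 a (hB ha)).trans (hc a ha), hn.trans h3⟩

lemma add (h : Attains tl hd p B c n) (h' : Attains tl hd p B c' n') :
    Attains tl hd p B (c + c') (n + n') := by
  obtain ⟨ι, _, y, h1, h2, h3⟩ := h
  obtain ⟨ι', _, y', h1', h2', h3'⟩ := h'
  refine ⟨ι ⊕ ι', inferInstance, Sum.elim y y', ?_, fun a ha => ?_, ?_⟩
  · rintro (i | i)
    · exact h1 i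
    · exact h1' i
  · have h4 := h2 a ha
    have h5 := h2' a ha
    rw [load_eq_sum] at h4 h5 ⊢
    simp only [Fintype.sum_sum_type, Sum.elim_inl, Sum.elim_inr, Pi.add_apply]
    omega
  · simp only [Fintype.sum_sum_type, Sum.elim_inl, Sum.elim_inr]
    omega

lemma sum {κ : Type} (s : Finset κ) {f : κ → α → ℕ} {g : κ → ℤ}
    (h : ∀ k ∈ s, Attains tl hd p B (f k) (g k)) :
    Attains tl hd p B (∑ k ∈ s, f k) (∑ k ∈ s, g k) := by
  induction s using Finset.induction_on with
  | empty => exact zero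
  | insert k s hk ih =>
    rw [sum_insert hk, sum_insert hk]
    exact (h k (mem_insert_self _ _)).add (ih fun l hl => h l (mem_insert_of_mem hl))

lemma nsmul (h : Attains tl hd p B c n) (t : ℕ) : Attains tl hd p B (t • c) (t * n) := by
  have := sum (range t) (f := fun _ => c) (g := fun _ => n) fun _ _ => h
  simpa using this

lemma of_nsmul (hp : CoreSupermodular tl hd p) {N : ℕ} (hN : 0 < N)
    (h : Attains tl hd p B (N • c) (N * n + 1)) : Attains tl hd p B c (n + 1) := by
  obtain ⟨ι, _, y, h1, h2, h3⟩ := h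
  obtain ⟨z, hz, hlam, hload, hsum⟩ := exists_coreLaminar hp y h1
  obtain ⟨col, hcol, hbal⟩ := exists_coloring z hz hlam hN
  have hfib : ∑ d ∈ range N, ∑ i with col i = d, p (z i) = ∑ i, p (z i) :=
    sum_fiberwise_of_maps_to (fun i _ => mem_range.2 (hcol i)) _
  obtain ⟨d, -, hd'⟩ : ∃ d ∈ range N, n < ∑ i with col i = d, p (z i) := by
    by_contra! hle
    have h4 := sum_le_sum hle
    rw [hfib] at h4
    simp only [sum_const, card_range, nsmul_eq_mul] at h4
    omega
  refine ⟨{i // col i = d}, inferInstance, fun i => z i, fun i => hz i, fun a ha => ?_, ?_⟩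
  · refine le_trans ?_ (hbal a (c a) ((hload a).trans (by simpa using h2 a ha)) d)
    rw [load]
    refine card_le_card_of_injOn (fun i => i.1) (fun i hi => ?_) Subtype.val_injective.injOn
    simp only [coe_filter, mem_univ, true_and, Set.mem_ofPred_eq] at hi ⊢
    exact ⟨hi, i.2⟩
  · rw [← sum_subtype (univ.filter fun i => col i = d) (by simp) fun i => p (z i)]
    omega

/-- If no family of petals entered at most once by each arc of `B` has value above `L`, then this
already holds for a set of at most `L` arcs of `B`. -/
lemma exists_card_le (hp : CoreSupermodular tl hd p) {L : ℕ}
    (h : ¬ Attains tl hd p B 1 (L + 1)) :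
    ∃ B' ⊆ B, B'.card ≤ L ∧ ¬ Attains tl hd p B' 1 (L + 1) := by
  obtain ⟨B₀, hB₀, hmin⟩ := Finset.exists_min_image
    (B.powerset.filter fun X => ¬ Attains tl hd p X 1 (L + 1)) card
    ⟨B, by simpa using h⟩
  simp only [mem_filter, mem_powerset] at hB₀ hmin
  refine ⟨B₀, hB₀.1, ?_, hB₀.2⟩
  obtain ⟨L₀, hL₀, hat, hnat⟩ : ∃ L₀ ≤ L, Attains tl hd p B₀ 1 (L₀ : ℤ) ∧
      ¬ Attains tl hd p B₀ 1 (L₀ + 1 : ℤ) := by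
    by_contra! hcon
    have hall : ∀ k ≤ L + 1, Attains tl hd p B₀ 1 (k : ℤ) := by
      intro k
      induction k with
      | zero => exact fun _ => zero
      | succ k ih =>
        intro hk
        have := hcon k (by omega) (ih (by omega))
        exact_mod_cast this
    exact hB₀.2 (by exact_mod_cast hall (L + 1) le_rfl)
  refine le_trans ?_ hL₀
  by_contra! hlt
  have hstep : ∀ a ∈ B₀, Attains tl hd p B₀ (fun b => if b = a then 2 else 1) (L₀ + 1 : ℤ) := by
    intro a ha
    have herase : Attains tl hd p (B₀.erase a) 1 (L + 1) := by
      by_contra hc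
      have := hmin _ ⟨(erase_subset a B₀).trans hB₀.1, hc⟩
      exact absurd (card_erase_lt_of_mem ha) (not_lt.2 this)
    obtain ⟨ι, _, y, h1, h2, h3⟩ := herase
    set t := load tl hd y a with ht
    have hy : Attains tl hd p B₀ (fun b => if b = a then t else 1) (L₀ + 1 : ℤ) := by
      refine ⟨ι, inferInstance, y, h1, fun b hb => ?_, by omega⟩
      by_cases hba : b = a
      · simp [hba, ht]
      · simpa [hba] using h2 b (mem_erase.2 ⟨hba, hb⟩)
    refine of_nsmul hp (Nat.succ_pos t) (((hy.add (hat.nsmul t)).mono (Subset.refl _)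
      (fun b _ => ?_) ?_))
    · by_cases hba : b = a
      · simp [hba]; omega
      · simp [hba]; omega
    · push_cast
      linarith
  refine hnat (of_nsmul hp (Nat.succ_pos B₀.card) ((sum B₀ hstep).mono (Subset.refl _)
    (fun b hb => ?_) ?_))
  · simp only [Finset.sum_apply, Pi.smul_apply, Pi.one_apply, smul_eq_mul, mul_one]
    rw [← add_sum_erase _ _ hb, sum_congr rfl fun a ha => if_neg (ne_of_mem_erase ha).symm]
    rw [sum_const, card_erase_of_mem hb]
    simp; omega
  · simp only [sum_const, nsmul_eq_mul]
    push_cast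
    have : (L₀ : ℤ) + 1 ≤ B₀.card := by exact_mod_cast hlt
    nlinarith

lemma of_petal {v : W} {Z : Finset W} (hZ : PetalAt tl hd v Z)
    (hB : ∀ a ∈ B, tl a ∈ Z ∨ hd a ∉ Z) (hpos : 0 < p Z) (L : ℕ) :
    Attains tl hd p B 1 L := by
  refine ⟨Fin L, inferInstance, fun _ => Z, fun _ => ⟨v, hZ⟩, fun a ha => ?_, ?_⟩
  · rw [load, filter_eq_empty_iff.2]
    · simp
    · rintro i - ⟨h1, h2⟩
      exact (hB a ha).elim h1 fun h => h h2
  · simp only [sum_const, card_univ, Fintype.card_fin, nsmul_eq_mul]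
    nlinarith

/-- An attained value is attained by an actual set of petals of positive value, provided that
every petal of positive value is entered by an arc of `B`. -/
lemma exists_finset (hp : CoreSupermodular tl hd p)
    (hpos : ∀ v Z, PetalAt tl hd v Z → 0 < p Z → ∃ a ∈ B, tl a ∉ Z ∧ hd a ∈ Z)
    (h : Attains tl hd p B 1 n) : ∃ 𝒵 : Finset (Finset W),
      (∀ Z ∈ 𝒵, ∃ v, PetalAt tl hd v Z) ∧
      (∀ a ∈ B, (𝒵.filter fun Z => tl a ∉ Z ∧ hd a ∈ Z).card ≤ 1) ∧
      (∀ Z ∈ 𝒵, ∀ Z' ∈ 𝒵, ∀ v, PetalAt tl hd v Z → PetalAt tl hd v Z' → Z ⊆ Z' ∨ Z' ⊆ Z) ∧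
      n ≤ ∑ Z ∈ 𝒵, p Z := by
  obtain ⟨ι, _, y, h1, h2, h3⟩ := h
  obtain ⟨z, hz, hlam, hload, hsum⟩ := exists_coreLaminar hp y h1
  have hone : ∀ a ∈ B, load tl hd z a ≤ 1 := fun a ha => (hload a).trans (h2 a ha)
  refine ⟨(univ.filter fun i => 0 < p (z i)).image z, ?_, fun a ha => ?_, ?_, ?_⟩
  · simp only [mem_image, forall_exists_index, and_imp]
    rintro _ i - rfl
    exact hz i
  · refine le_trans ?_ (hone a ha)
    rw [load, filter_image]
    refine card_image_le.trans (card_le_card fun i hi => ?_)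
    simp only [mem_filter, mem_univ, true_and] at hi ⊢
    exact hi.2
  · simp only [mem_image, forall_exists_index, and_imp]
    rintro _ i - rfl _ j - rfl v hi hj
    exact hlam i j v hi hj
  · rw [sum_image]
    · refine (h3.trans hsum).trans ?_
      rw [← sum_filter_add_sum_filter_not univ fun i => 0 < p (z i)]
      have : ∑ i with ¬ 0 < p (z i), p (z i) ≤ 0 := sum_nonpos fun i hi => by
        simpa using (mem_filter.1 hi).2
      linarith
    · intro i hi j hj hij
      simp only [coe_filter, mem_univ, true_and, Set.mem_ofPred_eq] at hi hj
      obtain ⟨v, hv⟩ := hz i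
      obtain ⟨a, ha, hta, hha⟩ := hpos v _ hv hi
      exact card_le_one.1 (hone a ha) i (by simp [hta, hha]) j (by simp [← hij, hta, hha])

end Attains

end Covering

section Growing

variable {W α : Type} [Fintype W] [DecidableEq W] [Fintype α] [DecidableEq α]
  {tl hd : α → W}

lemma IsArbor.extend {F : Finset α} {s : W} {U : Finset W} (h : IsArbor tl hd F s U) {a : α}
    (ht : tl a ∈ U) (hh : hd a ∉ U) : IsArbor tl hd (insert a F) s (insert (hd a) U) := by
  have hs := h.root_mem
  have hne : hd a ≠ s := fun he => hh (he ▸ hs)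
  refine ⟨?_, ?_, ?_, ?_, ?_⟩
  · exact h.1.trans (subset_insert _ _)
  · intro b hb
    rcases mem_insert.1 hb with rfl | hb
    · exact ⟨mem_insert_of_mem ht, mem_insert_self _ _⟩
    · exact ⟨mem_insert_of_mem (h.2.1 b hb).1, mem_insert_of_mem (h.2.1 b hb).2⟩
  · intro b hb
    rcases mem_insert.1 hb with rfl | hb
    · simpa using hne
    · exact h.2.2.1 b hb
  · intro w hw hws
    rw [filter_insert]
    rcases mem_insert.1 hw with rfl | hw
    · rw [if_pos rfl, card_eq_one]
      refine ⟨a, ?_⟩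
      have : F.filter (fun b => hd b = hd a) = ∅ :=
        filter_eq_empty_iff.2 fun {b} hb (he : hd b = hd a) => hh (he ▸ (h.2.1 b hb).2)
      rw [this]; rfl
    · rw [if_neg fun he : hd a = w => hh (he ▸ hw)]
      exact h.2.2.2.1 w hw hws
  · intro w hw
    refine ⟨s, mem_singleton_self s, ?_⟩
    rcases mem_insert.1 hw with rfl | hw
    · exact ((h.reach ht).mono (subset_insert _ _)).trans (DReach.arc (mem_insert_self _ _))
    · exact (h.reach hw).mono (subset_insert _ _)

/-- The roots of the arborescences containing `w`. -/
noncomputable def rootsAt (T : Finset W) (U : W → Finset W) (w : W) : Finset W :=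
  T.filter fun s => w ∈ U s

/-- The roots of the arborescences meeting `Z`. -/
noncomputable def rootsIn (T : Finset W) (U : W → Finset W) (Z : Finset W) : Finset W :=
  T.filter fun s => ∃ w ∈ Z, w ∈ U s

lemma mem_rootsAt {T : Finset W} {U : W → Finset W} {w s : W} :
    s ∈ rootsAt T U w ↔ s ∈ T ∧ w ∈ U s := by simp [rootsAt]

lemma mem_rootsIn {T : Finset W} {U : W → Finset W} {Z : Finset W} {s : W} :
    s ∈ rootsIn T U Z ↔ s ∈ T ∧ ∃ w ∈ Z, w ∈ U s := by simp [rootsIn]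

lemma rootsAt_subset_rootsIn {T : Finset W} {U : W → Finset W} {Z : Finset W} {w : W}
    (hw : w ∈ Z) : rootsAt T U w ⊆ rootsIn T U Z := fun s hs => by
  rw [mem_rootsAt] at hs; exact mem_rootsIn.2 ⟨hs.1, w, hw, hs.2⟩

lemma rootsIn_mono {T : Finset W} {U : W → Finset W} {Z Z' : Finset W} (h : Z ⊆ Z') :
    rootsIn T U Z ⊆ rootsIn T U Z' := fun s hs => by
  rw [mem_rootsIn] at hs ⊢
  obtain ⟨hs, w, hw, h'⟩ := hs
  exact ⟨hs, w, h hw, h'⟩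

lemma rootsIn_union {T : Finset W} {U : W → Finset W} {Z Z' : Finset W} :
    rootsIn T U (Z ∪ Z') = rootsIn T U Z ∪ rootsIn T U Z' := by
  ext s; simp only [mem_union, mem_rootsIn, or_and_right, exists_or, and_or_left]

/-- A partial packing `F`, `U` of arborescences rooted at `T` that can be completed using the
arcs of `R`. -/
structure PartialPacking (tl hd : α → W) (SS T : Finset W) (M : RankFn W) (R : Finset α)
    (F : W → Finset α) (U : W → Finset W) : Prop where
  arbor : ∀ s ∈ T, IsArbor tl hd (F s) s (U s)
  disj : ∀ s ∈ T, ∀ s' ∈ T, s ≠ s' → Disjoint (F s) (F s')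
  fresh : ∀ s ∈ T, Disjoint (F s) R
  indep : ∀ w, M.r (rootsAt T U w) = (rootsAt T U w).card
  cond : ∀ v Z, PetalAt tl hd v Z →
    M.r (SS ∩ PReach tl hd {v}) ≤ M.r (rootsIn T U Z) + inDegB tl hd R Z

namespace PartialPacking

variable {SS T : Finset W} {M : RankFn W} {R : Finset α} {F : W → Finset α} {U : W → Finset W}

lemma rootsAt_subset (h : PartialPacking tl hd SS T M R F U) (hT : T ⊆ SS) (w : W) :
    rootsAt T U w ⊆ SS ∩ PReach tl hd {w} := fun s hs => by
  rw [mem_rootsAt] at hs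
  rw [mem_inter, mem_PReach_singleton]
  exact ⟨hT hs.1, ((h.arbor s hs.1).reach hs.2).mono (subset_univ _)⟩

/-- A tight petal contains an arc along which some arborescence can be extended. -/
lemma exists_arc (h : PartialPacking tl hd SS T M R F U) (hT : T ⊆ SS) {w₀ : W} {X : Finset W}
    (hX : PetalAt tl hd w₀ X)
    (htight : M.r (SS ∩ PReach tl hd {w₀}) = M.r (rootsIn T U X) + inDegB tl hd R X)
    (hlt : M.r (rootsAt T U w₀) < M.r (rootsIn T U X))
    (hbelow : ∀ u, DReach tl hd univ u w₀ → ¬ DReach tl hd univ w₀ u →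
      M.r (rootsAt T U u) = M.r (SS ∩ PReach tl hd {u})) :
    ∃ a ∈ R, tl a ∈ X ∧ hd a ∈ X ∧ DReach tl hd univ w₀ (hd a) ∧
      ∃ s ∈ rootsAt T U (tl a), ¬ M.Cl (rootsAt T U (hd a)) s := by
  set Y := X.filter fun x => ∀ s ∈ rootsAt T U x, M.Cl (rootsAt T U w₀) s with hYdef
  have hYX : Y ⊆ X := filter_subset _ _
  have hY : PetalAt tl hd w₀ Y := by
    refine ⟨mem_filter.2 ⟨hX.1, fun s hs => RankFn.cl_of_mem hs⟩,
      fun z hz => hX.2.1 z (hYX hz), fun a ha => ?_⟩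
    rw [or_iff_not_imp_right]
    intro hna
    rw [hYdef, mem_filter] at ha ⊢
    refine ⟨(hX.2.2 a ha.1).resolve_right hna, fun s hs => ?_⟩
    have hs' := h.rootsAt_subset hT _ hs
    have hs'' : s ∈ SS ∩ PReach tl hd {hd a} :=
      inter_subset_inter_left (PReach_singleton_subset (DReach.arc (mem_univ a))) hs'
    refine RankFn.cl_trans ha.2 (RankFn.cl_of_r_le (h.rootsAt_subset hT _) ?_
      (RankFn.cl_of_mem hs''))
    exact (hbelow _ (hX.2.1 _ ha.1) hna).ge
  have hrY : M.r (rootsIn T U Y) = M.r (rootsAt T U w₀) := by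
    have h1 : ∀ s ∈ rootsIn T U Y, M.Cl (rootsAt T U w₀) s := by
      intro s hs
      obtain ⟨hsT, x, hx, hxs⟩ := mem_rootsIn.1 hs
      exact (mem_filter.1 hx).2 s (mem_rootsAt.2 ⟨hsT, hxs⟩)
    rw [← RankFn.r_union_of_cl h1, union_eq_right.2 (rootsAt_subset_rootsIn hY.1)]
  have hdeg : inDegB tl hd R X < inDegB tl hd R Y := by
    have := h.cond _ _ hY
    omega
  have hex : ∃ a ∈ R, (tl a ∉ Y ∧ hd a ∈ Y) ∧ ¬ (tl a ∉ X ∧ hd a ∈ X) := by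
    by_contra hcon
    push Not at hcon
    refine absurd (card_le_card fun a ha => ?_) hdeg.not_ge
    rw [mem_filter] at ha ⊢
    exact ⟨ha.1, hcon a ha.1 ha.2⟩
  obtain ⟨a, haR, ⟨h1, h2⟩, h3⟩ := hex
  have htX : tl a ∈ X := by
    by_contra hn
    exact h3 ⟨hn, hYX h2⟩
  refine ⟨a, haR, htX, hYX h2, (hY.2.2 a h2).resolve_left h1, ?_⟩
  rw [hYdef, mem_filter] at h1 h2
  push Not at h1
  obtain ⟨s, hs, hcl⟩ := h1 htX
  exact ⟨s, hs, fun hc => hcl (RankFn.cl_trans h2.2 hc)⟩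

/-- A tight petal separating the tail of an arc from its head and spanning the root `s` yields,
by uncrossing, a smaller tight petal. -/
lemma tight_inter (h : PartialPacking tl hd SS T M R F U) {w s : W} {X Z : Finset W}
    (hX : PetalAt tl hd w X) (hZ : PetalAt tl hd w Z)
    (htX : M.r (SS ∩ PReach tl hd {w}) = M.r (rootsIn T U X) + inDegB tl hd R X)
    (htZ : M.r (SS ∩ PReach tl hd {w}) = M.r (rootsIn T U Z) + inDegB tl hd R Z)
    (hsX : M.Cl (rootsIn T U X) s) (hsZ : M.Cl (rootsIn T U Z) s) :
    M.r (SS ∩ PReach tl hd {w}) = M.r (rootsIn T U (X ∩ Z)) + inDegB tl hd R (X ∩ Z) ∧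
      M.Cl (rootsIn T U (X ∩ Z)) s := by
  have h1 := h.cond _ _ (hX.union hZ)
  have h2 := h.cond _ _ (hX.inter hZ)
  have h3 := inDegB_submod (tl := tl) (hd := hd) R X Z
  have h4 := M.r_submod (insert s (rootsIn T U X)) (insert s (rootsIn T U Z))
  have h5 : M.r (rootsIn T U (X ∪ Z)) ≤
      M.r (insert s (rootsIn T U X) ∪ insert s (rootsIn T U Z)) := by
    rw [rootsIn_union]
    exact M.r_mono (union_subset_union (subset_insert _ _) (subset_insert _ _))
  have h6 : M.r (insert s (rootsIn T U (X ∩ Z))) ≤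
      M.r (insert s (rootsIn T U X) ∩ insert s (rootsIn T U Z)) :=
    M.r_mono (subset_inter (insert_subset_insert _ (rootsIn_mono inter_subset_left))
      (insert_subset_insert _ (rootsIn_mono inter_subset_right)))
  have h7 := M.r_mono (subset_insert s (rootsIn T U (X ∩ Z)))
  unfold RankFn.Cl at hsX hsZ ⊢
  omega

/-- Extending the arborescence rooted at `s` by the arc `a`. -/
lemma extend (h : PartialPacking tl hd SS T M R F U) {a : α} (haR : a ∈ R) {s : W}
    (hs : s ∈ rootsAt T U (tl a)) (hcl : ¬ M.Cl (rootsAt T U (hd a)) s)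
    (htight : ∀ Z, PetalAt tl hd (hd a) Z → tl a ∉ Z → M.Cl (rootsIn T U Z) s →
      M.r (SS ∩ PReach tl hd {hd a}) ≠ M.r (rootsIn T U Z) + inDegB tl hd R Z) :
    PartialPacking tl hd SS T M (R.erase a) (Function.update F s (insert a (F s)))
      (Function.update U s (insert (hd a) (U s))) := by
  obtain ⟨hsT, hsU⟩ := mem_rootsAt.1 hs
  have hhU : hd a ∉ U s := fun hh => hcl (RankFn.cl_of_mem (mem_rootsAt.2 ⟨hsT, hh⟩))
  have haF : ∀ t ∈ T, a ∉ F t := fun t ht ha => disjoint_left.1 (h.fresh t ht) ha haR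
  refine ⟨fun t ht => ?_, fun t ht t' ht' hne => ?_, fun t ht => ?_, fun w => ?_,
    fun v Z hZ => ?_⟩
  · by_cases he : t = s
    · subst he
      simpa using (h.arbor t ht).extend hsU hhU
    · simpa [Function.update_of_ne he] using h.arbor t ht
  · have hd' := h.disj t ht t' ht' hne
    by_cases he : t = s
    · subst he
      simp only [Function.update_self, Function.update_of_ne hne.symm, disjoint_insert_left]
      exact ⟨haF t' ht', hd'⟩
    · by_cases he' : t' = s
      · subst he'
        simp only [Function.update_self, Function.update_of_ne he, disjoint_insert_right]
        exact ⟨haF t ht, hd'⟩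
      · simpa [Function.update_of_ne he, Function.update_of_ne he'] using hd'
  · by_cases he : t = s
    · subst he
      simp only [Function.update_self, disjoint_insert_left]
      exact ⟨notMem_erase a R, (h.fresh t ht).mono_right (erase_subset _ _)⟩
    · simpa [Function.update_of_ne he] using (h.fresh t ht).mono_right (erase_subset _ _)
  · by_cases hw : w = hd a
    · subst hw
      have he : rootsAt T (Function.update U s (insert (hd a) (U s))) (hd a) =
          insert s (rootsAt T U (hd a)) := by
        ext t
        rw [mem_insert, mem_rootsAt, mem_rootsAt]
        by_cases ht : t = s
        · subst ht; simp [hsT]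
        · simp [ht]
      rw [he, M.r_insert_of_not_cl hcl, h.indep, card_insert_of_notMem]
      exact fun hm => hcl (RankFn.cl_of_mem hm)
    · have he : rootsAt T (Function.update U s (insert (hd a) (U s))) w = rootsAt T U w := by
        ext t
        rw [mem_rootsAt, mem_rootsAt]
        by_cases ht : t = s
        · subst ht; simp [hw]
        · simp [Function.update_of_ne ht]
      rw [he, h.indep]
  · have hsub : rootsIn T U Z ⊆ rootsIn T (Function.update U s (insert (hd a) (U s))) Z := by
      intro t ht
      obtain ⟨htT, w, hw, hwt⟩ := mem_rootsIn.1 ht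
      refine mem_rootsIn.2 ⟨htT, w, hw, ?_⟩
      by_cases he : t = s
      · subst he; simp [hwt]
      · simpa [Function.update_of_ne he] using hwt
    have hcond := h.cond v Z hZ
    by_cases hent : tl a ∉ Z ∧ hd a ∈ Z
    · have hdeg : inDegB tl hd R Z = inDegB tl hd (R.erase a) Z + 1 := by
        rw [inDegB, inDegB, filter_erase]
        exact (card_erase_add_one (mem_filter.2 ⟨haR, hent⟩)).symm
      have hsub' : insert s (rootsIn T U Z) ⊆
          rootsIn T (Function.update U s (insert (hd a) (U s))) Z :=
        insert_subset (mem_rootsIn.2 ⟨hsT, hd a, hent.2, by simp⟩) hsub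
      have hr := M.r_mono hsub'
      by_cases hc : M.Cl (rootsIn T U Z) s
      · have hZ' := hZ.at_head hent.1 hent.2
        have hP : PReach tl hd {v} = PReach tl hd {hd a} := by
          rw [← hZ.PReach_eq, hZ'.PReach_eq]
        have := htight Z hZ' hent.1 hc
        rw [← hP] at this
        have := M.r_mono hsub
        omega
      · rw [M.r_insert_of_not_cl hc] at hr
        omega
    · have hdeg : inDegB tl hd (R.erase a) Z = inDegB tl hd R Z := by
        rw [inDegB, inDegB, filter_erase, erase_eq_of_notMem]
        exact fun hm => hent (mem_filter.1 hm).2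
      have := M.r_mono hsub
      omega

/-- An incomplete partial packing can be extended. -/
lemma exists_extend (h : PartialPacking tl hd SS T M R F U) (hT : T ⊆ SS)
    (hinc : ∃ v, M.r (rootsAt T U v) ≠ M.r (SS ∩ PReach tl hd {v})) :
    ∃ a ∈ R, ∃ s, ∃ U', PartialPacking tl hd SS T M (R.erase a)
      (Function.update F s (insert a (F s))) U' := by
  obtain ⟨v, hv, hmin⟩ := Finset.exists_min_image
    (univ.filter fun v => M.r (rootsAt T U v) ≠ M.r (SS ∩ PReach tl hd {v}))
    (fun v => (PReach tl hd {v}).card) (by obtain ⟨v, hv⟩ := hinc; exact ⟨v, by simpa using hv⟩)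
  simp only [mem_filter, mem_univ, true_and] at hv hmin
  have hle : ∀ w Z, PetalAt tl hd w Z →
      M.r (rootsIn T U Z) ≤ M.r (SS ∩ PReach tl hd {w}) := by
    intro w Z hZ
    refine M.r_mono fun s hs => ?_
    obtain ⟨hsT, x, hx, hxs⟩ := mem_rootsIn.1 hs
    have := h.rootsAt_subset hT x (mem_rootsAt.2 ⟨hsT, hxs⟩)
    exact inter_subset_inter_left (PReach_singleton_subset (hZ.2.1 x hx)) this
  let Cand : Finset W → Prop := fun X => ∃ w, PetalAt tl hd w X ∧
    DReach tl hd univ v w ∧ DReach tl hd univ w v ∧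
    M.r (SS ∩ PReach tl hd {w}) = M.r (rootsIn T U X) + inDegB tl hd R X ∧
    M.r (rootsAt T U w) < M.r (rootsIn T U X)
  have hne : (univ.filter Cand).Nonempty := by
    have hP := petalAt_PReach (tl := tl) (hd := hd) v
    refine ⟨PReach tl hd {v}, mem_filter.2 ⟨mem_univ _, v, hP, .refl, .refl, ?_, ?_⟩⟩
    all_goals
      have h0 : inDegB tl hd R (PReach tl hd {v}) = 0 := by
        rw [inDegB, card_eq_zero, filter_eq_empty_iff]
        rintro a - ⟨h1, h2⟩
        rw [mem_PReach_singleton] at h1 h2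
        exact h1 ((DReach.arc (mem_univ a)).trans h2)
      have h1 := h.cond _ _ hP
      have h2 := hle _ _ hP
      have h3 := M.r_mono (h.rootsAt_subset hT v)
      omega
  obtain ⟨X, hX, hXmin⟩ := Finset.exists_min_image _ Finset.card hne
  obtain ⟨w₀, hpet, hvw, hwv, htX, hlt⟩ := (mem_filter.1 hX).2
  have hbelow : ∀ u, DReach tl hd univ u w₀ → ¬ DReach tl hd univ w₀ u →
      M.r (rootsAt T U u) = M.r (SS ∩ PReach tl hd {u}) := by
    intro u hu hnu
    by_contra hcon
    refine absurd (hmin u hcon) (card_lt_card ?_).not_ge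
    refine ⟨PReach_singleton_subset (hu.trans hwv), fun hs => hnu ?_⟩
    exact hwv.trans (mem_PReach_singleton.1 (hs (mem_PReach_singleton.2 .refl)))
  obtain ⟨a, haR, htaX, hhaX, hwa, s, hs, hcl⟩ := h.exists_arc hT hpet htX hlt hbelow
  refine ⟨a, haR, s, _, h.extend haR hs hcl fun Z hZ htZ hclZ htight => ?_⟩
  have hXa := hpet.change hhaX hwa
  have hP : PReach tl hd {w₀} = PReach tl hd {hd a} := by
    rw [← hpet.PReach_eq, hXa.PReach_eq]
  rw [hP] at htX
  have hclX : M.Cl (rootsIn T U X) s := RankFn.cl_of_mem (rootsAt_subset_rootsIn htaX hs)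
  obtain ⟨ht, hc⟩ := h.tight_inter hXa hZ htX htight hclX hclZ
  have hsub : rootsAt T U (hd a) ⊆ rootsIn T U (X ∩ Z) :=
    rootsAt_subset_rootsIn (mem_inter.2 ⟨hhaX, hZ.1⟩)
  have hlt' : M.r (rootsAt T U (hd a)) < M.r (rootsIn T U (X ∩ Z)) := by
    by_contra hcon
    exact hcl (RankFn.cl_of_r_le hsub (not_lt.1 hcon) hc)
  have hcard := hXmin (X ∩ Z) (mem_filter.2 ⟨mem_univ _, hd a, hXa.inter hZ, hvw.trans hwa,
    (hpet.2.1 _ hhaX).trans hwv, ht, hlt'⟩)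
  refine absurd hcard (card_lt_card ⟨inter_subset_left, fun hs => htZ ?_⟩).not_ge
  exact (mem_inter.1 (hs htaX)).2

/-- Every partial packing can be completed. -/
lemma complete (hT : T ⊆ SS) : ∀ {R : Finset α} {F : W → Finset α} {U : W → Finset W},
    PartialPacking tl hd SS T M R F U → ∃ R' F' U', PartialPacking tl hd SS T M R' F' U' ∧
      (∀ v, M.r (rootsAt T U' v) = M.r (SS ∩ PReach tl hd {v})) ∧
      ∀ s, F s ⊆ F' s ∧ F' s ⊆ F s ∪ R := by
  intro R
  induction R using Finset.strongInduction with
  | H R ih =>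
    intro F U h
    by_cases hinc : ∃ v, M.r (rootsAt T U v) ≠ M.r (SS ∩ PReach tl hd {v})
    · obtain ⟨a, haR, s, U₁, h₁⟩ := h.exists_extend hT hinc
      obtain ⟨R', F', U', h', hv, hF⟩ := ih _ (erase_ssubset haR) h₁
      refine ⟨R', F', U', h', hv, fun t => ?_⟩
      obtain ⟨h1, h2⟩ := hF t
      by_cases ht : t = s
      · subst ht
        rw [Function.update_self] at h1 h2
        refine ⟨(subset_insert _ _).trans h1, h2.trans fun b hb => ?_⟩
        simp only [mem_union, mem_insert, mem_erase] at hb ⊢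
        rcases hb with (rfl | hb) | hb
        exacts [Or.inr haR, Or.inl hb, Or.inr hb.2]
      · rw [Function.update_of_ne ht] at h1 h2
        exact ⟨h1, h2.trans (union_subset_union_right (erase_subset _ _))⟩
    · push Not at hinc
      exact ⟨R, F, U, h, hinc, fun s => ⟨Subset.refl _, subset_union_left⟩⟩

end PartialPacking

end Growing

section Assembly

variable {W α : Type} [Fintype W] [DecidableEq W] [Fintype α] [DecidableEq α]
  {tl hd : α → W} {SS : Finset W} {M : RankFn W}

lemma RankFn.exists_cl_erase {X : Finset W} (h : M.r X ≠ X.card) :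
    ∃ s ∈ X, M.Cl (X.erase s) s := by
  obtain ⟨J, -, hJX, hJ, hcard⟩ := M.exists_indep_extension (I := ∅) (X := X)
    (by rw [M.r_empty, card_empty]) (empty_subset _)
  have hne : J ≠ X := by rintro rfl; exact h hJ
  obtain ⟨s, hsX, hsJ⟩ := exists_of_ssubset (hJX.ssubset_of_ne hne)
  refine ⟨s, hsX, RankFn.Cl.mono ?_ (X := J) fun x hx => mem_erase.2 ⟨?_, hJX hx⟩⟩
  · exact M.cl_of_r_le hJX (by omega) (RankFn.cl_of_mem hsX)
  · rintro rfl; exact hsJ hx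

/-- The demand of `Z` that has to be covered by root arcs. -/
noncomputable def demand (tl hd : α → W) (SS : Finset W) (M : RankFn W) (Z : Finset W) : ℤ :=
  (M.r (SS ∩ PReach tl hd Z) : ℤ) - M.r (SS ∩ Z)
    - inDegB tl hd (univ.filter fun a => tl a ∉ SS) Z

/-- Every petal of positive demand is entered by an arc of `B`. -/
def Feasible (tl hd : α → W) (SS : Finset W) (M : RankFn W) (B : Finset α) : Prop :=
  ∀ v Z, PetalAt tl hd v Z → (∀ a ∈ B, tl a ∈ Z ∨ hd a ∉ Z) → demand tl hd SS M Z ≤ 0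

/-- The tails of the arcs of `B` with head `v`. -/
noncomputable def tails (tl hd : α → W) (B : Finset α) (v : W) : Finset W :=
  (B.filter fun a => hd a = v).image tl

lemma mem_tails {B : Finset α} {v s : W} : s ∈ tails tl hd B v ↔ ∃ a ∈ B, hd a = v ∧ tl a = s := by
  simp [tails, and_assoc]

lemma tails_mono {B B' : Finset α} (h : B ⊆ B') (v : W) :
    tails tl hd B v ⊆ tails tl hd B' v := fun s hs => by
  obtain ⟨a, ha, h'⟩ := mem_tails.1 hs
  exact mem_tails.2 ⟨a, h ha, h'⟩

lemma coreSupermodular_demand : CoreSupermodular tl hd (demand tl hd SS M) := by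
  intro v Z Z' hZ hZ'
  have h1 := M.r_submod (SS ∩ Z) (SS ∩ Z')
  rw [← inter_union_distrib_left, ← inter_inter_distrib_left] at h1
  have h2 := inDegB_submod (tl := tl) (hd := hd) (univ.filter fun a => tl a ∉ SS) Z Z'
  simp only [demand, (hZ.union hZ').PReach_eq, (hZ.inter hZ').PReach_eq, hZ.PReach_eq,
    hZ'.PReach_eq]
  omega

lemma inDegB_union_sources_le (hhead : ∀ a : α, hd a ∉ SS) {Y : Finset W} (hY : Y ⊆ SS)
    (B : Finset α) (Z : Finset W) : inDegB tl hd B (Z ∪ Y) ≤ inDegB tl hd B Z := by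
  refine card_le_card fun a ha => ?_
  simp only [mem_filter, mem_union, not_or] at ha ⊢
  exact ⟨ha.1, ha.2.1.1, ha.2.2.resolve_right fun h => hhead a (hY h)⟩

/-- A feasible set of root arcs contains a feasible one that is independent at each vertex. -/
lemma Feasible.exists_indep (hhead : ∀ a : α, hd a ∉ SS) {B : Finset α}
    (hB : ∀ a ∈ B, tl a ∈ SS) (hf : Feasible tl hd SS M B) :
    ∃ B' ⊆ B, Feasible tl hd SS M B' ∧
      ∀ v, M.r (tails tl hd B' v) = (tails tl hd B' v).card := by
  obtain ⟨B₀, hB₀, hmin⟩ := Finset.exists_min_image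
    (B.powerset.filter fun X => Feasible tl hd SS M X) card ⟨B, by simpa using hf⟩
  simp only [mem_filter, mem_powerset] at hB₀ hmin
  refine ⟨B₀, hB₀.1, hB₀.2, fun v => ?_⟩
  by_contra hdep
  obtain ⟨s, hs, hcl⟩ := RankFn.exists_cl_erase hdep
  obtain ⟨a, ha, hav, rfl⟩ := mem_tails.1 hs
  have hnf : ¬ Feasible tl hd SS M (B₀.erase a) := fun hc =>
    absurd (card_erase_lt_of_mem ha) (not_lt.2 (hmin _ ⟨(erase_subset a B₀).trans hB₀.1, hc⟩))
  simp only [Feasible, not_forall, not_le] at hnf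
  obtain ⟨w, Z, hZ, hent, hpos⟩ := hnf
  have haZ : tl a ∉ Z ∧ hd a ∈ Z := by
    by_contra hcon
    refine absurd (hB₀.2 w Z hZ fun b hb => ?_) (not_le.2 hpos)
    by_cases hba : b = a
    · subst hba; tauto
    · exact hent b (mem_erase.2 ⟨hba, hb⟩)
  have haS : tl a ∈ SS := hB a (hB₀.1 ha)
  have hYS : ({tl a} : Finset W) ⊆ SS := by simpa using haS
  have hZ' : PetalAt tl hd w (Z ∪ {tl a}) := by
    refine hZ.union_sources (fun y hy => ?_) fun b hb => hhead b (hYS hb)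
    rw [mem_singleton.1 hy]
    exact (DReach.arc (mem_univ a)).trans (hZ.2.1 _ haZ.2)
  have hle := hB₀.2 w _ hZ' fun b hb => by
    by_cases hba : b = a
    · subst hba; simp
    · rcases hent b (mem_erase.2 ⟨hba, hb⟩) with h | h
      · exact Or.inl (mem_union_left _ h)
      · refine Or.inr fun h' => ?_
        rcases mem_union.1 h' with h' | h'
        exacts [h h', hhead b (hYS h')]
  have hcl' : M.Cl (SS ∩ Z) (tl a) := by
    refine hcl.mono fun t ht => ?_
    obtain ⟨hne, ht⟩ := mem_erase.1 ht
    obtain ⟨b, hb, hbv, rfl⟩ := mem_tails.1 ht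
    have hba : b ≠ a := by rintro rfl; exact hne rfl
    refine mem_inter.2 ⟨hB b (hB₀.1 hb), ?_⟩
    refine (hent b (mem_erase.2 ⟨hba, hb⟩)).resolve_right fun h => h ?_
    rw [hbv, ← hav]; exact haZ.2
  have hins : SS ∩ (Z ∪ {tl a}) = insert (tl a) (SS ∩ Z) := by
    rw [inter_union_distrib_left, inter_eq_right.2 hYS, union_comm, ← insert_eq]
  have hdeg := inDegB_union_sources_le (tl := tl) hhead hYS (univ.filter fun a => tl a ∉ SS) Z
  rw [demand, hZ'.PReach_eq, hins, hcl'] at hle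
  rw [demand, hZ.PReach_eq] at hpos
  omega

/-- An independent set of root arcs can be enlarged to an independent one of prescribed size. -/
lemma exists_indep_superset (hhead : ∀ a : α, hd a ∉ SS) {B : Finset α}
    (hB : ∀ a ∈ B, tl a ∈ SS) (hind : ∀ v, M.r (tails tl hd B v) = (tails tl hd B v).card)
    {n : ℕ} (hBn : B.card ≤ n)
    (hn : n ≤ max B.card
      (∑ v ∈ SSᶜ, M.r (tails tl hd (univ.filter fun a => tl a ∈ SS) v))) :
    ∃ B', B ⊆ B' ∧ (∀ a ∈ B', tl a ∈ SS) ∧ B'.card = n ∧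
      ∀ v, M.r (tails tl hd B' v) = (tails tl hd B' v).card := by
  have hBA : B ⊆ univ.filter fun a => tl a ∈ SS := fun a ha => by simpa using hB a ha
  choose J hBJ hJA hJ hJr using fun v => M.exists_indep_extension (hind v) (tails_mono hBA v)
  set B₁ : Finset α := univ.filter fun a => tl a ∈ SS ∧ tl a ∈ J (hd a) with hB₁
  have hBB₁ : B ⊆ B₁ := fun a ha => by
    simp only [hB₁, mem_filter, mem_univ, true_and]
    exact ⟨hB a ha, hBJ _ (mem_tails.2 ⟨a, ha, rfl, rfl⟩)⟩
  have hcard : ∑ v ∈ SSᶜ, M.r (tails tl hd (univ.filter fun a => tl a ∈ SS) v) ≤ B₁.card := by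
    rw [card_eq_sum_card_fiberwise (f := hd) (t := SSᶜ) fun a _ => by simpa using hhead a]
    refine sum_le_sum fun v _ => ?_
    rw [← hJr v]
    refine le_trans (card_le_card fun s hs => ?_) (card_image_le (f := tl))
    obtain ⟨a, ha, rfl, rfl⟩ := mem_tails.1 (hJA v hs)
    refine mem_image.2 ⟨a, ?_, rfl⟩
    simp only [hB₁, mem_filter, mem_univ, true_and] at ha ⊢
    exact ⟨⟨ha, hs⟩, trivial⟩
  obtain ⟨B', h1, h2, h3⟩ := exists_subsuperset_card_eq hBB₁ hBn
    (hn.trans (max_le (card_le_card hBB₁) hcard))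
  refine ⟨B', h1, fun a ha => (mem_filter.1 (h2 ha)).2.1, h3, fun v => ?_⟩
  refine RankFn.indep_subset (hJ v) fun s hs => ?_
  obtain ⟨a, ha, rfl, rfl⟩ := mem_tails.1 hs
  exact (mem_filter.1 (h2 ha)).2.2

lemma isArbor_singleton (s : W) : IsArbor tl hd ∅ s {s} :=
  ⟨Subset.refl _, by simp, by simp, fun w hw hw' => absurd hw hw', fun w hw => ⟨w, hw, .refl⟩⟩

/-- A feasible set of root arcs that is independent at each vertex yields a partial packing. -/
lemma Feasible.partialPacking (hhead : ∀ a : α, hd a ∉ SS)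
    (hout : ∀ s ∈ SS, (univ.filter fun a => tl a = s).card = 1) {B : Finset α}
    (hf : Feasible tl hd SS M B)
    (hB : ∀ a ∈ B, tl a ∈ SS) (hind : ∀ v, M.r (tails tl hd B v) = (tails tl hd B v).card) :
    PartialPacking tl hd SS (SS.filter fun s => M.r {s} = 1) M (univ.filter fun a => tl a ∉ SS)
      (fun s => B.filter fun a => tl a = s)
      (fun s => insert s ((B.filter fun a => tl a = s).image hd)) where
  arbor s hs := by
    have hs' := (mem_filter.1 hs).1
    have hle : (B.filter fun a => tl a = s).card ≤ 1 :=
      (hout s hs') ▸ card_le_card (filter_subset_filter _ (subset_univ _))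
    rcases Nat.le_one_iff_eq_zero_or_eq_one.1 hle with h | h
    · rw [card_eq_zero] at h
      simpa [h] using isArbor_singleton s
    · obtain ⟨a, ha⟩ := card_eq_one.1 h
      have haB : a ∈ B.filter fun a => tl a = s := by rw [ha]; exact mem_singleton_self a
      have hta : tl a = s := (mem_filter.1 haB).2
      have := (isArbor_singleton (tl := tl) (hd := hd) s).extend (a := a) (by simp [hta])
        (by rw [mem_singleton]; rintro rfl; exact hhead a hs')
      rw [ha, image_singleton, pair_comm]
      simpa using this
  disj s _ s' _ hne := by
    rw [disjoint_left]
    intro a ha ha'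
    exact hne ((mem_filter.1 ha).2.symm.trans (mem_filter.1 ha').2)
  fresh s hs := by
    rw [disjoint_left]
    intro a ha ha'
    exact (mem_filter.1 ha').2 (hB a (mem_filter.1 ha).1)
  indep w := by
    by_cases hw : w ∈ SS
    · by_cases hr : M.r {w} = 1
      · refine RankFn.indep_subset (B := {w}) (by simpa using hr) fun s hs => ?_
        obtain ⟨-, hs⟩ := mem_rootsAt.1 hs
        rcases mem_insert.1 hs with rfl | hs
        · exact mem_singleton_self _
        · obtain ⟨a, -, rfl⟩ := mem_image.1 hs
          exact absurd hw (hhead a)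
      · rw [eq_empty_of_forall_notMem (s := rootsAt _ _ w), M.r_empty, card_empty]
        intro s hs
        obtain ⟨hsT, hs⟩ := mem_rootsAt.1 hs
        rcases mem_insert.1 hs with rfl | hs
        · exact hr (mem_filter.1 hsT).2
        · obtain ⟨a, -, rfl⟩ := mem_image.1 hs
          exact hhead a hw
    · refine RankFn.indep_subset (hind w) fun s hs => ?_
      obtain ⟨hsT, hs⟩ := mem_rootsAt.1 hs
      rcases mem_insert.1 hs with rfl | hs
      · exact absurd (mem_filter.1 hsT).1 hw
      · obtain ⟨a, ha, rfl⟩ := mem_image.1 hs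
        exact mem_tails.2 ⟨a, (mem_filter.1 ha).1, rfl, (mem_filter.1 ha).2⟩
  cond v Z hZ := by
    set Y := (B.filter fun a => hd a ∈ Z).image tl with hY
    have hYmem : ∀ {y}, y ∈ Y ↔ ∃ a ∈ B, hd a ∈ Z ∧ tl a = y := by simp [hY, and_assoc]
    have hYS : Y ⊆ SS := fun y hy => by
      obtain ⟨a, ha, -, rfl⟩ := hYmem.1 hy; exact hB a ha
    have hZ' : PetalAt tl hd v (Z ∪ Y) := by
      refine hZ.union_sources (fun y hy => ?_) fun b hb => hhead b (hYS hb)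
      obtain ⟨a, ha, haZ, rfl⟩ := hYmem.1 hy
      exact (DReach.arc (mem_univ a)).trans (hZ.2.1 _ haZ)
    have hle := hf v _ hZ' fun a ha => by
      by_cases haZ : hd a ∈ Z
      · exact Or.inl (mem_union_right _ (hYmem.2 ⟨a, ha, haZ, rfl⟩))
      · refine Or.inr fun h => ?_
        rcases mem_union.1 h with h | h
        exacts [haZ h, hhead a (hYS h)]
    have hdeg := inDegB_union_sources_le (tl := tl) hhead hYS (univ.filter fun a => tl a ∉ SS) Z
    have hr : M.r (SS ∩ (Z ∪ Y)) ≤ M.r (rootsIn (SS.filter fun s => M.r {s} = 1)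
        (fun s => insert s ((B.filter fun a => tl a = s).image hd)) Z) := by
      rw [← M.r_filter_nonloop]
      refine M.r_mono fun s hs => ?_
      obtain ⟨hs, hnl⟩ := mem_filter.1 hs
      obtain ⟨hsS, hs⟩ := mem_inter.1 hs
      refine mem_rootsIn.2 ⟨mem_filter.2 ⟨hsS, hnl⟩, ?_⟩
      rcases mem_union.1 hs with hs | hs
      · exact ⟨s, hs, mem_insert_self _ _⟩
      · obtain ⟨a, ha, haZ, hta⟩ := hYmem.1 hs
        exact ⟨hd a, haZ, mem_insert_of_mem (mem_image.2 ⟨a, mem_filter.2 ⟨ha, hta⟩, rfl⟩)⟩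
    rw [demand, hZ'.PReach_eq] at hle
    omega

/-- A feasible set of root arcs that is independent at each vertex is the set of root arcs of a
matroid-reachability-based packing. -/
lemma Feasible.exists_packing (hhead : ∀ a : α, hd a ∉ SS)
    (hout : ∀ s ∈ SS, (univ.filter fun a => tl a = s).card = 1) {B : Finset α}
    (hf : Feasible tl hd SS M B)
    (hB : ∀ a ∈ B, tl a ∈ SS) (hind : ∀ v, M.r (tails tl hd B v) = (tails tl hd B v).card) :
    ∃ (T : Finset W) (F : W → Finset α) (U : W → Finset W),
      T ⊆ SS ∧ (∀ s ∈ T, IsArbor tl hd (F s) s (U s)) ∧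
      (∀ s ∈ T, ∀ s' ∈ T, s ≠ s' → Disjoint (F s) (F s')) ∧
      (∀ w : W, IsBasisOf M.r (T.filter fun s => w ∈ U s) (SS ∩ PReach tl hd {w})) ∧
      (T.biUnion F).filter (fun a => tl a ∈ SS) = B := by
  have hT : (SS.filter fun s => M.r {s} = 1) ⊆ SS := filter_subset _ _
  obtain ⟨R, F, U, h, hfull, hF⟩ := (hf.partialPacking hhead hout hB hind).complete hT
  refine ⟨_, F, U, hT, h.arbor, h.disj,
    fun w => ⟨h.rootsAt_subset hT w, h.indep w, hfull w⟩, ?_⟩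
  ext a
  simp only [mem_filter, mem_biUnion]
  constructor
  · rintro ⟨⟨s, -, ha⟩, haS⟩
    rcases mem_union.1 ((hF s).2 ha) with ha | ha
    · exact (mem_filter.1 ha).1
    · exact absurd haS (mem_filter.1 ha).2
  · refine fun ha => ⟨⟨tl a, ⟨hB a ha, ?_⟩, (hF _).1 (mem_filter.2 ⟨ha, rfl⟩)⟩, hB a ha⟩
    have := RankFn.indep_subset (X := {tl a}) (hind (hd a))
      (by simpa using mem_tails.2 ⟨a, ha, rfl, rfl⟩)
    simpa using this

/-- The rank deficit of a petal is at most the number of arcs of the packing entering it. -/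
lemma r_le_add_inDegB {T : Finset W} {F : W → Finset α} {U : W → Finset W}
    (harb : ∀ s ∈ T, IsArbor tl hd (F s) s (U s))
    (hdisj : ∀ s ∈ T, ∀ s' ∈ T, s ≠ s' → Disjoint (F s) (F s'))
    (hbas : ∀ w : W, IsBasisOf M.r (T.filter fun s => w ∈ U s) (SS ∩ PReach tl hd {w}))
    {v : W} {Z : Finset W} (hZ : PetalAt tl hd v Z) :
    M.r (SS ∩ PReach tl hd Z) ≤ M.r (SS ∩ Z) + inDegB tl hd (T.biUnion F) Z := by
  obtain ⟨hsub, hindep, hrank⟩ := hbas v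
  set X := T.filter fun s => v ∈ U s with hX
  have h1 : (X ∩ Z).card ≤ M.r (SS ∩ Z) := by
    rw [← RankFn.indep_subset hindep inter_subset_left]
    exact M.r_mono (inter_subset_inter_right (hsub.trans inter_subset_left))
  have h2 : ∀ s ∈ X \ Z, ∃ a ∈ F s, tl a ∉ Z ∧ hd a ∈ Z := by
    intro s hs
    obtain ⟨hs, hsZ⟩ := mem_sdiff.1 hs
    obtain ⟨hsT, hsv⟩ := mem_filter.1 hs
    exact ((harb s hsT).reach hsv).exists_entering hsZ hZ.1
  have hTmem : ∀ {s}, s ∈ X \ Z → s ∈ T := fun hs => (mem_filter.1 (mem_sdiff.1 hs).1).1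
  have h3 : (X \ Z).card ≤ inDegB tl hd (T.biUnion F) Z := by
    refine card_le_card_of_forall_subsingleton (fun s a => a ∈ F s) (fun s hs => ?_)
      fun a _ s hs s' hs' => ?_
    · obtain ⟨a, ha, haZ⟩ := h2 s hs
      exact ⟨a, mem_filter.2 ⟨mem_biUnion.2 ⟨s, hTmem hs, ha⟩, haZ⟩, ha⟩
    · by_contra hne
      exact disjoint_left.1 (hdisj s (hTmem hs.1) s' (hTmem hs'.1) hne) hs.2 hs'.2
  have h4 := card_inter_add_card_sdiff X Z
  rw [hZ.PReach_eq]
  omega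

/-- The number of root arcs of a packing is at most the sum of the ranks of the root
neighbourhoods. -/
lemma card_rootArcs_le (hhead : ∀ a : α, hd a ∉ SS)
    (hout : ∀ s ∈ SS, (univ.filter fun a => tl a = s).card = 1)
    {T : Finset W} {F : W → Finset α} {U : W → Finset W}
    (harb : ∀ s ∈ T, IsArbor tl hd (F s) s (U s))
    (hbas : ∀ w : W, IsBasisOf M.r (T.filter fun s => w ∈ U s) (SS ∩ PReach tl hd {w})) :
    ((T.biUnion F).filter fun a => tl a ∈ SS).card ≤
      ∑ v ∈ SSᶜ, M.r ((univ.filter fun a => tl a ∈ SS ∧ hd a = v).image tl) := by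
  rw [card_eq_sum_card_fiberwise (f := hd) (t := SSᶜ) fun a _ => by simpa using hhead a]
  refine sum_le_sum fun v _ => ?_
  set E := ((T.biUnion F).filter fun a => tl a ∈ SS).filter fun a => hd a = v with hE
  have hEmem : ∀ {a}, a ∈ E → (∃ s ∈ T, a ∈ F s) ∧ tl a ∈ SS ∧ hd a = v := by
    intro a ha
    simpa [hE, and_assoc] using ha
  have hinj : Set.InjOn tl E := fun a ha b hb hab =>
    card_le_one.1 (hout _ (hEmem ha).2.1).le a (by simp) b (by simp [hab])
  rw [← card_image_of_injOn hinj, ← RankFn.indep_subset (hbas v).2.1 (X := E.image tl) ?_]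
  · refine M.r_mono (image_subset_image fun a ha => ?_)
    simpa using (hEmem ha).2
  · intro t ht
    obtain ⟨a, ha, rfl⟩ := mem_image.1 ht
    obtain ⟨⟨s, hs, has⟩, haS, rfl⟩ := hEmem ha
    obtain ⟨htU, hhU⟩ := (harb s hs).2.1 a has
    have hst : s = tl a := ((harb s hs).reach htU).eq_of_no_arc fun b hb => hhead b (hb ▸ haS)
    subst hst
    exact mem_filter.2 ⟨hs, hhU⟩

lemma inDegB_le_add (B : Finset α) (Z : Finset W) :
    inDegB tl hd B Z ≤ inDegB tl hd (univ.filter fun a => tl a ∉ SS) Z +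
      inDegB tl hd (B.filter fun a => tl a ∈ SS) Z := by
  refine le_trans (card_le_card fun a ha => ?_) (card_union_le _ _)
  simp only [mem_union, mem_filter, mem_univ, true_and] at ha ⊢
  tauto

lemma inDegB_mono {B B' : Finset α} (h : B ⊆ B') (Z : Finset W) :
    inDegB tl hd B Z ≤ inDegB tl hd B' Z :=
  card_le_card (filter_subset_filter _ h)

lemma sum_inDegB_le_card {B : Finset α} {𝒵 : Finset (Finset W)}
    (h : ∀ a ∈ B, (𝒵.filter fun Z => tl a ∉ Z ∧ hd a ∈ Z).card ≤ 1) :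
    ∑ Z ∈ 𝒵, inDegB tl hd B Z ≤ B.card := by
  simp only [inDegB, card_filter] at h ⊢
  rw [sum_comm, card_eq_sum_ones]
  exact sum_le_sum h

/-- A small feasible set of root arcs exists if the demands of every disjoint core-laminar set of
petals sum up to a small value. -/
lemma exists_feasible (ℓ' : ℕ)
    (hcut : ∀ Z : Finset W, IsPetal tl hd Z →
      (M.r (SS ∩ PReach tl hd Z) : ℤ) - M.r (SS ∩ Z) ≤ (inDegB tl hd univ Z : ℤ))
    (hlam : ∀ 𝒵 : Finset (Finset W), (∀ Z ∈ 𝒵, IsPetal tl hd Z) →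
      (∀ a : α, tl a ∈ SS → (𝒵.filter fun Z => tl a ∉ Z ∧ hd a ∈ Z).card ≤ 1) →
      (∀ Z ∈ 𝒵, ∀ Z' ∈ 𝒵, (petalCore tl hd Z ∩ petalCore tl hd Z').Nonempty →
        Z ⊆ Z' ∨ Z' ⊆ Z) →
      ∑ Z ∈ 𝒵, demand tl hd SS M Z ≤ (ℓ' : ℤ)) :
    ∃ B : Finset α, (∀ a ∈ B, tl a ∈ SS) ∧ B.card ≤ ℓ' ∧ Feasible tl hd SS M B := by
  have hnot : ¬ Attains tl hd (demand tl hd SS M) (univ.filter fun a => tl a ∈ SS) 1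
      (ℓ' + 1) := by
    intro h
    obtain ⟨𝒵, h1, h2, h3, h4⟩ := h.exists_finset coreSupermodular_demand fun v Z hZ hpos => by
      by_contra! hno
      have h5 := hcut Z hZ.isPetal
      have h6 := inDegB_le_add (tl := tl) (hd := hd) (SS := SS) univ Z
      have h7 : inDegB tl hd (univ.filter fun a => tl a ∈ SS) Z = 0 := by
        rw [inDegB, card_eq_zero, filter_eq_empty_iff]
        exact fun a ha h => hno a ha h.1 h.2
      rw [demand] at hpos
      omega
    have h5 := hlam 𝒵 (fun Z hZ => isPetal_iff.2 (h1 Z hZ)) (fun a ha => h2 a (by simpa using ha))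
      fun Z hZ Z' hZ' ⟨v, hv⟩ => by
        rw [mem_inter, mem_petalCore (isPetal_iff.2 (h1 Z hZ)),
          mem_petalCore (isPetal_iff.2 (h1 Z' hZ'))] at hv
        exact h3 Z hZ Z' hZ' v hv.1 hv.2
    omega
  obtain ⟨B, hB, hcard, hnB⟩ := Attains.exists_card_le coreSupermodular_demand hnot
  refine ⟨B, fun a ha => by simpa using hB ha, hcard, fun v Z hZ hent => ?_⟩
  by_contra! hpos
  exact hnB (by exact_mod_cast Attains.of_petal hZ hent hpos (ℓ' + 1))

end Assembly

/-- **Intermediary theorem (Theorem 13 of the paper).** `D = (V ∪ S, A*)` is a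
digraph where `SS` is the vertex set `S`, no arc enters `S`, and exactly one arc
leaves each vertex of `S`; `A'` is the set of arcs leaving `S` and `A = A* − A'`.
`M` is a matroid on `S` (formalized as a rank function on the whole vertex type
that only depends on the intersection with `S`). There is an
`M`-reachability-based packing of arborescences in `D` using at least `ℓ` and at
most `ℓ'` arcs of `A'` iff (i) `ℓ ≤ ℓ'`, (ii) `Σ_{v∈V} r_M(N⁻_{A'}(v)) ≥ ℓ`,
(iii) `r_M(S ∩ P_Z) − r_M(S ∩ Z) ≤ d⁻_{A*}(Z)` for every petal `Z`, and
(iv) `Σ_{Z∈𝒵} (r_M(S ∩ P_Z) − r_M(S ∩ Z) − d⁻_A(Z)) ≤ ℓ'` for every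
`A'`-disjoint core-laminar set `𝒵` of petals. -/
theorem matroid_reachability_based_packing_with_limited_root_arcs
    {W α : Type} [Fintype W] [DecidableEq W] [Fintype α] [DecidableEq α]
    (tl hd : α → W) (SS : Finset W) (M : RankFn W) (ℓ ℓ' : ℕ)
    (hsupp : ∀ X : Finset W, M.r X = M.r (X ∩ SS))
    (hhead : ∀ a : α, hd a ∉ SS)
    (hout : ∀ s ∈ SS, (univ.filter fun a => tl a = s).card = 1) :
    (∃ (T : Finset W) (F : W → Finset α) (U : W → Finset W),
        T ⊆ SS ∧
        (∀ s ∈ T, IsArbor tl hd (F s) s (U s)) ∧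
        (∀ s ∈ T, ∀ s' ∈ T, s ≠ s' → Disjoint (F s) (F s')) ∧
        (∀ w : W, IsBasisOf M.r (T.filter fun s => w ∈ U s)
          (SS ∩ PReach tl hd {w})) ∧
        ℓ ≤ ((T.biUnion F).filter fun a => tl a ∈ SS).card ∧
        ((T.biUnion F).filter fun a => tl a ∈ SS).card ≤ ℓ')
    ↔ (ℓ ≤ ℓ' ∧
       ℓ ≤ ∑ v ∈ SSᶜ, M.r ((univ.filter fun a => tl a ∈ SS ∧ hd a = v).image tl) ∧
       (∀ Z : Finset W, IsPetal tl hd Z →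
          (M.r (SS ∩ PReach tl hd Z) : ℤ) - M.r (SS ∩ Z)
            ≤ (inDegB tl hd univ Z : ℤ)) ∧
       (∀ 𝒵 : Finset (Finset W),
          (∀ Z ∈ 𝒵, IsPetal tl hd Z) →
          (∀ a : α, tl a ∈ SS →
            (𝒵.filter fun Z => tl a ∉ Z ∧ hd a ∈ Z).card ≤ 1) →
          (∀ Z ∈ 𝒵, ∀ Z' ∈ 𝒵,
            (petalCore tl hd Z ∩ petalCore tl hd Z').Nonempty →
            Z ⊆ Z' ∨ Z' ⊆ Z) →
          ∑ Z ∈ 𝒵, ((M.r (SS ∩ PReach tl hd Z) : ℤ) - M.r (SS ∩ Z)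
              - inDegB tl hd (univ.filter fun a => tl a ∉ SS) Z)
            ≤ (ℓ' : ℤ))) := by
  constructor
  · rintro ⟨T, F, U, hT, harb, hdisj, hbas, hlow, hupp⟩
    refine ⟨hlow.trans hupp, hlow.trans (card_rootArcs_le hhead hout harb hbas),
      fun Z hZ => ?_, fun 𝒵 hpet hone _ => ?_⟩
    · obtain ⟨v, hv⟩ := isPetal_iff.1 hZ
      have h1 := r_le_add_inDegB harb hdisj hbas hv
      have h2 := inDegB_mono (tl := tl) (hd := hd) (subset_univ (T.biUnion F)) Z
      omega
    · have h1 : ∀ Z ∈ 𝒵, (M.r (SS ∩ PReach tl hd Z) : ℤ) - M.r (SS ∩ Z)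
          - inDegB tl hd (univ.filter fun a => tl a ∉ SS) Z
          ≤ (inDegB tl hd ((T.biUnion F).filter fun a => tl a ∈ SS) Z : ℤ) := by
        intro Z hZ
        obtain ⟨v, hv⟩ := isPetal_iff.1 (hpet Z hZ)
        have h2 := r_le_add_inDegB harb hdisj hbas hv
        have h3 := inDegB_le_add (tl := tl) (hd := hd) (SS := SS) (T.biUnion F) Z
        omega
      have h4 := sum_inDegB_le_card (tl := tl) (hd := hd)
        (B := (T.biUnion F).filter fun a => tl a ∈ SS) (𝒵 := 𝒵)
        fun a ha => hone a (mem_filter.1 ha).2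
      refine (sum_le_sum h1).trans ?_
      exact_mod_cast h4.trans hupp
  · rintro ⟨hle, hsum, hcut, hlam⟩
    obtain ⟨B₀, hB₀, hcard₀, hf₀⟩ := exists_feasible ℓ' hcut hlam
    obtain ⟨B₁, hB₁, hf₁, hind₁⟩ := hf₀.exists_indep hhead hB₀
    have htails : ∀ v, tails tl hd (univ.filter fun a => tl a ∈ SS) v =
        (univ.filter fun a => tl a ∈ SS ∧ hd a = v).image tl := fun v => by
      rw [tails, filter_filter]
    obtain ⟨B, hB₁B, hB, hcard, hind⟩ := exists_indep_superset hhead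
      (fun a ha => hB₀ a (hB₁ ha)) hind₁ (le_max_left B₁.card ℓ)
      (max_le_max le_rfl (by simpa only [htails] using hsum))
    have hf : Feasible tl hd SS M B := fun v Z hZ hent =>
      hf₁ v Z hZ fun a ha => hent a (hB₁B ha)
    obtain ⟨T, F, U, hT, harb, hdisj, hbas, hused⟩ := hf.exists_packing hhead hout hB hind
    refine ⟨T, F, U, hT, harb, hdisj, hbas, ?_, ?_⟩
    · rw [hused, hcard]
      exact le_max_right _ _
    · rw [hused, hcard]
      exact max_le ((card_le_card hB₁).trans hcard₀) hle
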